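/- arXiv:1912.07102 — 4 statements merged into one kernel-verified Lean document; each statement's English description precedes it below -/
import Mathlib

section
/- Let p be a prime, q = p^n a prime power, and m ≥ 2 an integer. Then K(GL_m(F_q)) = ℚ({ω_d(r) : 1 ≤ d ≤ m and r ∈ (ℤ/(q^d − 1)ℤ)^×}), i.e. the field generated over ℚ by all irreducible character values of GL_m(F_q) equals the field generated over ℚ by the sums ω_d(r) = Σ_{k=0}^{d−1} ζ_{q^d−1}^{r q^k} for 1 ≤ d ≤ m and r coprime to q^d − 1. -/
open CategoryTheory

/-- `zeta N` is the root of unity `e^{2 π i / N}`. -/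
noncomputable def zeta (N : ℕ) : ℂ := Complex.exp (2 * Real.pi * Complex.I / N)

/-- `charField G` is the field `K(G)` generated over `ℚ` by all values of
irreducible complex characters of `G`. -/
noncomputable def charField (G : Type) [Group G] : IntermediateField ℚ ℂ :=
  IntermediateField.adjoin ℚ
    {x : ℂ | ∃ V : FDRep ℂ G, Simple V ∧ ∃ g : G, V.character g = x}

/-- `charFieldAt G d` is the field `K_d(G)` generated over `ℚ` by the values of
irreducible complex characters of `G` at elements of order exactly `d`. -/
noncomputable def charFieldAt (G : Type) [Group G] (d : ℕ) : IntermediateField ℚ ℂ :=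
  IntermediateField.adjoin ℚ
    {x : ℂ | ∃ V : FDRep ℂ G, Simple V ∧ ∃ g : G, orderOf g = d ∧ V.character g = x}

/-- The traces of the powers of a complex endomorphism of finite order are power sums of roots of
unity. -/
theorem LinearMap.exists_trace_pow_eq_sum {V : Type*} [AddCommGroup V] [Module ℂ V]
    [FiniteDimensional ℂ V] (A : Module.End ℂ V) {M : ℕ} (hM : M ≠ 0) (hA : A ^ M = 1) :
    ∃ (ι : Type) (_ : Fintype ι) (z : ι → ℂ) (c : ι → ℕ), (∀ i, z i ^ M = 1) ∧
      ∀ t : ℕ, LinearMap.trace ℂ V (A ^ t) = ∑ i, (c i : ℂ) * z i ^ t := by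
  classical
  have hss : A.IsSemisimple := by
    refine Module.End.isSemisimple_of_squarefree_aeval_eq_zero
      (p := Polynomial.X ^ M - 1) ?_ (by simp [hA])
    have : (Polynomial.X ^ M - 1 : Polynomial ℂ).Separable := by
      have := Polynomial.separable_X_pow_sub_C (F := ℂ) (n := M) 1 (by exact_mod_cast hM) one_ne_zero
      simpa using this
    exact this.squarefree
  let ι : Type := {z : ℂ // A.HasEigenvalue z}
  let val : ι → ℂ := Subtype.val
  have : Finite ι := inferInstanceAs (Finite A.Eigenvalues)
  have : Fintype ι := Fintype.ofFinite ι
  have hint : DirectSum.IsInternal (fun z : ι => A.eigenspace (val z)) := by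
    refine DirectSum.isInternal_submodule_of_iSupIndep_of_iSup_eq_top ?_ ?_
    · exact A.eigenspaces_iSupIndep.comp Subtype.val_injective
    · rw [eq_top_iff, ← hss.iSup_eigenspace_eq_top]
      refine iSup_le fun z => ?_
      by_cases hz : A.HasEigenvalue z
      · exact le_iSup (fun z : ι => A.eigenspace (val z)) (⟨z, hz⟩ : ι)
      · have : A.eigenspace z = ⊥ := by
          simpa [Module.End.hasEigenvalue_iff] using hz
        simp [this]
  have hpow : ∀ (z : ℂ) (t : ℕ) (v : V), v ∈ A.eigenspace z → (A ^ t) v = z ^ t • v := by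
    intro z t v hv
    rw [Module.End.mem_eigenspace_iff] at hv
    induction t with
    | zero => simp
    | succ k ih => rw [pow_succ', Module.End.mul_apply, ih, map_smul, hv, smul_smul, pow_succ]
  refine ⟨ι, inferInstance, val,
    fun z => Module.finrank ℂ (A.eigenspace (val z)), fun z => ?_, fun t => ?_⟩
  · obtain ⟨v, hv⟩ := (show A.HasEigenvalue (val z) from z.2).exists_hasEigenvector
    have h := hpow _ M v hv.1
    rw [hA, Module.End.one_apply] at h
    have : (val z ^ M - 1) • v = 0 := by rw [sub_smul, ← h, one_smul, sub_self]
    exact sub_eq_zero.1 ((smul_eq_zero.1 this).resolve_right hv.2)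
  · have hmaps : ∀ z : ι,
        Set.MapsTo (A ^ t) (A.eigenspace (val z)) (A.eigenspace (val z)) := by
      intro z v hv
      rw [SetLike.mem_coe] at hv ⊢
      rw [hpow _ t v hv]
      exact Submodule.smul_mem _ _ hv
    rw [LinearMap.trace_eq_sum_trace_restrict hint hmaps]
    refine Finset.sum_congr rfl fun z _ => ?_
    have : (A ^ t).restrict (hmaps z) = (val z ^ t) • LinearMap.id := by
      ext v
      exact hpow _ t v v.2
    rw [this, map_smul, LinearMap.trace_id, smul_eq_mul, mul_comm]

/-- A simple module over the complex group algebra of a finite group is a simple object of the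
category of finite-dimensional representations. -/
theorem FDRep.simple_of_isSimpleModule {G : Type} [Group G] [Finite G] {V : Type} [AddCommGroup V]
    [Module ℂ V] [FiniteDimensional ℂ V] [Module (MonoidAlgebra ℂ G) V]
    [IsScalarTower ℂ (MonoidAlgebra ℂ G) V] [IsSimpleModule (MonoidAlgebra ℂ G) V]
    (ρ : Representation ℂ G V) (hρ : ∀ g v, ρ g v = MonoidAlgebra.of ℂ G g • v) :
    Simple (FDRep.of ρ) := by
  have : NeZero (Nat.card G : ℂ) := ⟨by exact_mod_cast Nat.card_pos.ne'⟩
  have hnt : Nontrivial V := IsSimpleModule.nontrivial (MonoidAlgebra ℂ G) V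
  rw [FDRep.simple_iff_end_is_rank_one]
  have hscalar : ∀ f : FDRep.of ρ ⟶ FDRep.of ρ, ∃ c : ℂ, c • 𝟙 (FDRep.of ρ) = f := by
    intro f
    let φ : V →ₗ[ℂ] V := ((FDRep.forget₂HomLinearEquiv _ _).symm f).hom.toLinearMap
    have hφ : ∀ (g : G) (v : V), φ (ρ g v) = ρ g (φ v) := fun g v =>
      LinearMap.congr_fun (((FDRep.forget₂HomLinearEquiv _ _).symm f).hom.isIntertwining' g) v
    have hφ' : ∀ (a : MonoidAlgebra ℂ G) (v : V), φ (a • v) = a • φ v := by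
      intro a v
      induction a using MonoidAlgebra.induction_on with
      | of y => rw [← hρ, ← hρ, hφ]
      | add a b ha hb => rw [add_smul, add_smul, map_add, ha, hb]
      | smul r a ha => rw [smul_assoc, smul_assoc, map_smul, ha]
    let ψ : Module.End (MonoidAlgebra ℂ G) V :=
      { toFun := φ, map_add' := φ.map_add, map_smul' := hφ' }
    obtain ⟨c, hc⟩ := (IsSimpleModule.algebraMap_end_bijective_of_isAlgClosed (V := V)
      (A := MonoidAlgebra ℂ G) ℂ).2 ψ
    refine ⟨c, (FDRep.forget₂HomLinearEquiv _ _).symm.injective ?_⟩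
    ext v
    have := LinearMap.congr_fun hc v
    exact this
  have hne : 𝟙 (FDRep.of ρ) ≠ 0 := by
    intro h0
    obtain ⟨v, hv⟩ := exists_ne (0 : V)
    apply hv
    have := congrArg (fun f : FDRep.of ρ ⟶ FDRep.of ρ =>
      ((FDRep.forget₂HomLinearEquiv _ _).symm f).hom.toLinearMap v) h0
    simp only [map_zero] at this
    exact this
  exact (finrank_eq_one_iff_of_nonzero' _ hne).2 hscalar

/-- A central element of the complex group algebra of a finite group vanishes if it has trace zero
in every irreducible representation. -/
theorem MonoidAlgebra.eq_zero_of_forall_trace_eq_zero {G : Type} [Group G] [Finite G]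
    (z : MonoidAlgebra ℂ G) (hcomm : ∀ a, a * z = z * a)
    (H : ∀ V : FDRep ℂ G, Simple V →
      LinearMap.trace ℂ V (MonoidAlgebra.lift ℂ (Module.End ℂ V) G V.ρ z) = 0) : z = 0 := by
  have := Fintype.ofFinite G
  have : NeZero (Nat.card G : ℂ) := ⟨by exact_mod_cast Nat.card_pos.ne'⟩
  rw [← Submodule.mem_bot (MonoidAlgebra ℂ G),
    ← IsSemisimpleRing.jacobson_eq_bot (MonoidAlgebra ℂ G),
    Ring.jacobson_eq_sInf_isMaximal, Submodule.mem_sInf]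
  intro I hI
  replace hI : Ideal.IsMaximal I := hI
  have : IsSimpleModule (MonoidAlgebra ℂ G) (MonoidAlgebra ℂ G ⧸ I) :=
    isSimpleModule_iff_isCoatom.2 (Ideal.isMaximal_def.1 hI)
  let ρ : Representation ℂ G (MonoidAlgebra ℂ G ⧸ I) :=
    ((Algebra.lsmul ℂ ℂ (MonoidAlgebra ℂ G ⧸ I)).toMonoidHom).comp (MonoidAlgebra.of ℂ G)
  have : FiniteDimensional ℂ (MonoidAlgebra ℂ G ⧸ I) :=
    Module.Finite.of_surjective ((Submodule.mkQ I).restrictScalars ℂ) (Submodule.mkQ_surjective I)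
  have htr := H _ (FDRep.simple_of_isSimpleModule ρ fun _ _ => rfl)
  let ψ : Module.End (MonoidAlgebra ℂ G) (MonoidAlgebra ℂ G ⧸ I) :=
    { toFun := fun v => z • v, map_add' := smul_add z
      map_smul' := fun a v => by simp only [smul_smul, hcomm, RingHom.id_apply] }
  obtain ⟨c, hc⟩ := (IsSimpleModule.algebraMap_end_bijective_of_isAlgClosed
    (V := MonoidAlgebra ℂ G ⧸ I) (A := MonoidAlgebra ℂ G) ℂ).2 ψ
  have hc' : ∀ v : MonoidAlgebra ℂ G ⧸ I, c • v = z • v := fun v => LinearMap.congr_fun hc v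
  have hlift : MonoidAlgebra.lift ℂ (Module.End ℂ (MonoidAlgebra ℂ G ⧸ I)) G ρ =
      Algebra.lsmul ℂ ℂ (MonoidAlgebra ℂ G ⧸ I) :=
    (MonoidAlgebra.lift ℂ _ G).apply_symm_apply (Algebra.lsmul ℂ ℂ (MonoidAlgebra ℂ G ⧸ I))
  have hsc : MonoidAlgebra.lift ℂ (Module.End ℂ (MonoidAlgebra ℂ G ⧸ I)) G ρ z =
      c • LinearMap.id := by
    rw [hlift]
    ext v
    exact (hc' v).symm
  change LinearMap.trace ℂ (MonoidAlgebra ℂ G ⧸ I)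
    (MonoidAlgebra.lift ℂ (Module.End ℂ (MonoidAlgebra ℂ G ⧸ I)) G ρ z) = 0 at htr
  rw [hsc, map_smul, LinearMap.trace_id, smul_eq_mul, mul_eq_zero] at htr
  have hnt : Nontrivial (MonoidAlgebra ℂ G ⧸ I) := IsSimpleModule.nontrivial (MonoidAlgebra ℂ G) _
  have hc0 : c = 0 := htr.resolve_right (by exact_mod_cast Module.finrank_pos.ne')
  have h1 := hc' (Submodule.Quotient.mk 1)
  rw [hc0, zero_smul, ← Submodule.Quotient.mk_smul, smul_eq_mul, mul_one] at h1
  exact (Submodule.Quotient.mk_eq_zero I).1 h1.symm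

/-- The irreducible characters of a finite group separate its conjugacy classes. -/
theorem isConj_of_forall_character_eq {G : Type} [Group G] [Finite G] {g h : G}
    (H : ∀ V : FDRep ℂ G, Simple V → V.character g = V.character h) : IsConj g h := by
  classical
  have := Fintype.ofFinite G
  have hz : ∑ x : G, (MonoidAlgebra.of ℂ G (x * g * x⁻¹) -
      MonoidAlgebra.of ℂ G (x * h * x⁻¹)) = 0 := by
    refine MonoidAlgebra.eq_zero_of_forall_trace_eq_zero _ (fun a => ?_) fun V hV => ?_
    · induction a using MonoidAlgebra.induction_on with
      | of y =>
        rw [Finset.mul_sum, Finset.sum_mul]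
        conv_rhs => rw [← Equiv.sum_comp (Equiv.mulLeft y)]
        refine Finset.sum_congr rfl fun x _ => ?_
        simp only [mul_sub, sub_mul, ← map_mul, Equiv.coe_mulLeft]
        congr 2 <;> group
      | add a b ha hb => rw [add_mul, mul_add, ha, hb]
      | smul r a ha => rw [smul_mul_assoc, mul_smul_comm, ha]
    · have hchar : ∀ x, LinearMap.trace ℂ V (V.ρ x) = V.character x := fun x => rfl
      simp only [map_sum, map_sub, MonoidAlgebra.lift_of, hchar, FDRep.char_conj, H V hV, sub_self,
        Finset.sum_const_zero]
  by_contra hconj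
  have hne : ∀ x : G, x * h * x⁻¹ ≠ g := fun x hx => hconj (isConj_iff.2 ⟨x, hx⟩).symm
  have hcoef := congrArg (fun a : MonoidAlgebra ℂ G => a.coeff g) hz
  simp [MonoidAlgebra.coeff_sum, Finsupp.single_apply, hne] at hcoef
  exact @hcoef 1 (by simp)

theorem Nat.exists_mul_modEq_one {t M : ℕ} (ht : t.Coprime M) : ∃ s, t * s ≡ 1 [MOD M] := by
  rcases lt_or_ge 1 M with hM | hM
  · obtain ⟨s, -, hs⟩ := Nat.exists_mul_mod_eq_one_of_coprime ht hM
    exact ⟨s, by rw [Nat.ModEq, hs, Nat.mod_eq_of_lt hM]⟩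
  · interval_cases M
    · exact ⟨1, by simp [(Nat.coprime_zero_right t).1 ht, Nat.ModEq]⟩
    · exact ⟨1, Nat.modEq_one⟩

theorem pow_eq_pow_of_modEq_of_pow_eq_one {R : Type*} [Monoid R] {x : R} {M a b : ℕ}
    (hx : x ^ M = 1) (h : a ≡ b [MOD M]) : x ^ a = x ^ b := by
  rw [pow_eq_pow_mod a hx, h, ← pow_eq_pow_mod b hx]

section Polynomial

open Polynomial

variable {F : Type*} [Field F] [Fintype F]

/-- If `t` is congruent to a power of `q` modulo `q ^ deg p - 1`, then raising to the `t`-th power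
maps the roots of `p` to roots of `p`. -/
theorem Irreducible.dvd_expand_of_modEq {p : F[X]} (hp : Irreducible p) {M t k : ℕ} (hM : M ≠ 0)
    (hpM : p ∣ X ^ M - 1)
    (hk : t ≡ Fintype.card F ^ k [MOD Fintype.card F ^ p.natDegree - 1]) :
    p ∣ expand F t p := by
  have : Fact (Irreducible p) := ⟨hp⟩
  have hroot : ∀ f : F[X], p ∣ f ↔ aeval (AdjoinRoot.root p) f = 0 := fun f => by
    rw [AdjoinRoot.aeval_eq, AdjoinRoot.mk_eq_zero]
  have hx0 : AdjoinRoot.root p ≠ 0 := by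
    intro h0
    have := (hroot _).1 hpM
    simp [h0, hM] at this
  have hx : AdjoinRoot.root p ^ (Fintype.card F ^ p.natDegree - 1) = 1 := by
    have h1 := (hroot _).1 (hp.natDegree_dvd_iff_dvd_X_pow_card_pow_sub_X.1 dvd_rfl)
    rw [map_sub, map_pow, aeval_X, sub_eq_zero, Nat.card_eq_fintype_card,
      ← Nat.sub_add_cancel (Nat.one_le_pow p.natDegree _ Fintype.card_pos), pow_succ] at h1
    exact mul_right_cancel₀ hx0 (h1.trans (one_mul _).symm)
  rw [hroot, expand_aeval, pow_eq_pow_of_modEq_of_pow_eq_one hx hk]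
  have hfrob : AdjoinRoot.root p ^ Fintype.card F ^ k =
      ((FiniteField.frobeniusAlgHom F (AdjoinRoot p)) ^ k) (AdjoinRoot.root p) := by
    induction k generalizing t with
    | zero => simp
    | succ k ih =>
      rw [pow_succ' (FiniteField.frobeniusAlgHom F (AdjoinRoot p)) k, AlgHom.mul_apply,
        ← ih Nat.ModEq.rfl, FiniteField.coe_frobeniusAlgHom]
      exact (pow_succ (Fintype.card F) k ▸ pow_mul _ _ _)
  rw [hfrob, aeval_algHom_apply, (hroot p).1 dvd_rfl, map_zero]

theorem AdjoinRoot.exists_addEquiv_mk_mul {p : F[X]} (hp : Irreducible p) {e M t : ℕ}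
    (hM : M ≠ 0) (hpM : p ^ e ∣ X ^ M - 1) (ht : t.Coprime M)
    (hk : e ≠ 0 → ∃ k, t ≡ Fintype.card F ^ k [MOD Fintype.card F ^ p.natDegree - 1]) :
    ∃ Φ : AdjoinRoot (p ^ e) ≃+ AdjoinRoot (p ^ e),
      ∀ r v, Φ (AdjoinRoot.mk (p ^ e) r * v) = AdjoinRoot.mk (p ^ e) (expand F t r) * Φ v := by
  have hexp : p ^ e ∣ expand F t (p ^ e) := by
    rcases eq_or_ne e 0 with rfl | he
    · simp
    · obtain ⟨k, hk⟩ := hk he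
      rw [map_pow]
      exact pow_dvd_pow_of_dvd (hp.dvd_expand_of_modEq hM ((dvd_pow_self p he).trans hpM) hk) e
  let x := AdjoinRoot.root (p ^ e)
  have hx : x ^ M = 1 := by
    have : aeval x (X ^ M - 1 : F[X]) = 0 := by
      rw [AdjoinRoot.aeval_eq, AdjoinRoot.mk_eq_zero]
      exact hpM
    simpa [sub_eq_zero] using this
  let φ : AdjoinRoot (p ^ e) →ₐ[F] AdjoinRoot (p ^ e) :=
    AdjoinRoot.liftAlgHom (p ^ e) (Algebra.ofId F _) (x ^ t) (by
      change aeval (x ^ t) (p ^ e) = 0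
      rw [← expand_aeval, AdjoinRoot.aeval_eq, AdjoinRoot.mk_eq_zero]
      exact hexp)
  have hφ : φ x = x ^ t := AdjoinRoot.liftAlgHom_root ..
  obtain ⟨s, hs⟩ := Nat.exists_mul_modEq_one ht
  have hsurj : Function.Surjective φ := by
    intro v
    induction v using AdjoinRoot.induction_on with
    | ih f =>
      refine ⟨aeval (x ^ s) f, ?_⟩
      rw [← aeval_algHom_apply, map_pow, hφ, ← pow_mul,
        pow_eq_pow_of_modEq_of_pow_eq_one hx hs, pow_one, AdjoinRoot.aeval_eq]
  have : FiniteDimensional F (AdjoinRoot (p ^ e)) :=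
    (AdjoinRoot.powerBasis (pow_ne_zero e hp.ne_zero)).finite
  exact ⟨AddEquiv.ofBijective φ.toLinearMap
    ⟨LinearMap.injective_iff_surjective.2 hsurj, hsurj⟩, fun r v => by
      change φ (AdjoinRoot.mk (p ^ e) r * v) = _ * φ v
      rw [map_mul, ← AdjoinRoot.aeval_eq, ← aeval_algHom_apply, hφ, ← expand_aeval,
        AdjoinRoot.aeval_eq]⟩

theorem LinearMap.exists_linearEquiv_conj_pow {V : Type*} [AddCommGroup V] [Module F V]
    [FiniteDimensional F V] (f : Module.End F V) {M t : ℕ} (hM : M ≠ 0) (hf : f ^ M = 1)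
    (ht : t.Coprime M)
    (hk : ∀ d, 1 ≤ d → d ≤ Module.finrank F V →
      ∃ k, t ≡ Fintype.card F ^ k [MOD Fintype.card F ^ d - 1]) :
    ∃ Φ : V ≃ₗ[F] V, ∀ v, Φ (f v) = (f ^ t) (Φ v) := by
  classical
  obtain ⟨ι, _, p, hp, e, ⟨L⟩⟩ := Module.equiv_directSum_of_isTorsion
    (Module.AEval.isTorsion_of_finiteDimensional F V f)
  let Q : ι → Type _ := fun i => F[X] ⧸ Submodule.span F[X] {p i ^ e i}
  have hdvd : ∀ (i : ι) (r : F[X]), aeval f r = 0 → p i ^ e i ∣ r := by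
    intro i r hr
    have hann : ∀ w : DirectSum ι Q, r • w = 0 := by
      intro w
      obtain ⟨v, rfl⟩ := L.surjective w
      obtain ⟨v, rfl⟩ := (Module.AEval.of F V f).surjective v
      rw [← map_smul, ← Module.AEval.of_aeval_smul, hr, zero_smul, map_zero, map_zero]
    have h1 := hann (DirectSum.lof F[X] ι Q i (Submodule.Quotient.mk 1))
    rw [← map_smul, ← Submodule.Quotient.mk_smul, smul_eq_mul, mul_one] at h1
    have h2 := congrArg (fun w => w i) h1
    rw [DirectSum.lof_apply] at h2
    exact Ideal.mem_span_singleton.1 ((Submodule.Quotient.mk_eq_zero _).1 h2)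
  have hblock : ∀ i, ∃ Φ : Q i ≃+ Q i, ∀ (r : F[X]) v, Φ (r • v) = expand F t r • Φ v := by
    intro i
    refine AdjoinRoot.exists_addEquiv_mk_mul (hp i) hM (hdvd i _ (by simp [hf])) ht
      fun he => hk _ (hp i).natDegree_pos ?_
    rw [← LinearMap.charpoly_natDegree f]
    exact natDegree_le_of_dvd ((dvd_pow_self _ he).trans
      (hdvd i _ (LinearMap.aeval_self_charpoly f))) f.charpoly_monic.ne_zero
  choose Φ hΦ using hblock
  let Ψ : DirectSum ι Q ≃+ DirectSum ι Q := DFinsupp.mapRange.addEquiv Φ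
  have hΨ : ∀ (r : F[X]) w, Ψ (r • w) = expand F t r • Ψ w := fun r w =>
    DFinsupp.ext fun i => hΦ i r (w i)
  let T : V ≃+ V := (((Module.AEval.of F V f).toAddEquiv.trans L.toAddEquiv).trans Ψ).trans
    ((Module.AEval.of F V f).toAddEquiv.trans L.toAddEquiv).symm
  have hT : ∀ (r : F[X]) v, T (aeval f r v) = aeval f (expand F t r) (T v) := by
    intro r v
    have h1 : ∀ (r : F[X]) v, L (Module.AEval.of F V f (aeval f r v)) =
        r • L (Module.AEval.of F V f v) := fun r v => by
      rw [← map_smul, ← Module.AEval.of_aeval_smul]; rfl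
    apply ((Module.AEval.of F V f).toAddEquiv.trans L.toAddEquiv).injective
    change L (Module.AEval.of F V f (T (aeval f r v))) =
      L (Module.AEval.of F V f (aeval f (expand F t r) (T v)))
    have h2 : ∀ v, L (Module.AEval.of F V f (T v)) = Ψ (L (Module.AEval.of F V f v)) := fun v =>
      ((Module.AEval.of F V f).toAddEquiv.trans L.toAddEquiv).apply_symm_apply _
    rw [h2, h1, hΨ, h1, h2]
  refine ⟨{ T with map_smul' := fun a v => ?_ }, fun v => ?_⟩
  · simpa [Module.algebraMap_end_apply] using hT (C a) v
  · simpa using hT X v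

end Polynomial

theorem Matrix.GeneralLinearGroup.isConj_pow {F : Type*} [Field F] [Fintype F] {m : ℕ}
    (g : GL (Fin m) F) {M t : ℕ} (hM : M ≠ 0) (hg : g ^ M = 1) (ht : t.Coprime M)
    (hk : ∀ d, 1 ≤ d → d ≤ m → ∃ k, t ≡ Fintype.card F ^ k [MOD Fintype.card F ^ d - 1]) :
    IsConj g (g ^ t) := by
  let e := Matrix.GeneralLinearGroup.toLin (n := Fin m) (R := F)
  have hf : (e g : Module.End F (Fin m → F)) ^ M = 1 := by
    rw [← Units.val_pow_eq_pow_val, ← map_pow, hg, map_one, Units.val_one]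
  obtain ⟨Φ, hΦ⟩ := LinearMap.exists_linearEquiv_conj_pow _ hM hf ht (by simpa using hk)
  let u := (LinearMap.GeneralLinearGroup.generalLinearEquiv F (Fin m → F)).symm Φ
  rw [isConj_iff]
  refine ⟨e.symm u, mul_inv_eq_of_eq_mul (e.injective (Units.ext (LinearMap.ext fun v => ?_)))⟩
  rw [map_mul, map_mul, map_pow, e.apply_symm_apply]
  exact hΦ v

section Polynomial

open Polynomial

theorem IsConj.aeval_eq_zero {F A : Type*} [CommSemiring F] [Semiring A] [Algebra F A] {a b : Aˣ}
    (h : IsConj a b) {r : F[X]} (hr : aeval (a : A) r = 0) : aeval (b : A) r = 0 := by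
  obtain ⟨c, rfl⟩ := isConj_iff.1 h
  have : ∀ s : F[X], aeval ((c * a * c⁻¹ : Aˣ) : A) s = c * aeval (a : A) s * (c⁻¹ : Aˣ) := by
    intro s
    induction s using Polynomial.induction_on' with
    | add p q hp hq => rw [map_add, map_add, hp, hq, mul_add, add_mul]
    | monomial n x =>
      rw [aeval_monomial, aeval_monomial, ← Units.val_pow_eq_pow_val, conj_pow, Units.val_mul,
        Units.val_mul, Units.val_pow_eq_pow_val, ← mul_assoc, ← mul_assoc, ← mul_assoc,
        Algebra.commutes x (c : A)]
  rw [this, hr, mul_zero, zero_mul]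

theorem Matrix.exists_algHom_prod_of_finrank_le (F K : Type*) [Field F] [Field K] [Algebra F K]
    [FiniteDimensional F K] {m : ℕ} (h : Module.finrank F K ≤ m) :
    ∃ ρ : K × F →ₐ[F] Matrix (Fin m) (Fin m) F, ∀ x, ρ x = 0 → x.1 = 0 := by
  let T : (K × (Fin (m - Module.finrank F K) → F)) ≃ₗ[F] (Fin m → F) :=
    LinearEquiv.ofFinrankEq _ _ (by simp [Nat.add_sub_cancel' h])
  refine ⟨(LinearMap.toMatrixAlgEquiv'.toAlgHom.comp (T.conjAlgEquiv F).toAlgHom).comp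
    ((LinearMap.prodMapAlgHom F K (Fin (m - Module.finrank F K) → F)).comp
      (AlgHom.prodMap (Algebra.lmul F K) (Algebra.ofId F _))), fun x hx => ?_⟩
  have h1 := LinearMap.toMatrixAlgEquiv'.injective (hx.trans (map_zero _).symm)
  have h2 := (T.conjAlgEquiv F).injective (h1.trans (map_zero _).symm)
  exact (mul_one x.1).symm.trans (congrArg (fun f => (f (1, 0)).1) h2)

theorem exists_modEq_card_pow_of_isConj_pow {F : Type*} [Field F] [Fintype F] {m M t d : ℕ}
    (ht : t.Coprime M) (hd : 1 ≤ d) (hdm : d ≤ m) (hM : Fintype.card F ^ d - 1 ∣ M)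
    (H : ∀ g : GL (Fin m) F, IsConj g (g ^ t)) :
    ∃ k, t ≡ Fintype.card F ^ k [MOD Fintype.card F ^ d - 1] := by
  obtain ⟨p, hp⟩ := CharP.exists F
  have : Fact p.Prime := ⟨CharP.char_is_prime F p⟩
  have : NeZero d := ⟨by omega⟩
  let K := FiniteField.Extension F p d
  obtain ⟨ρ, hρ⟩ := Matrix.exists_algHom_prod_of_finrank_le F K
    ((FiniteField.finrank_extension F p d).trans_le hdm)
  obtain ⟨α, hα⟩ := IsCyclic.exists_generator (α := Kˣ)
  have hord : orderOf α = Fintype.card F ^ d - 1 := by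
    rw [orderOf_eq_card_of_forall_mem_zpowers hα, Nat.card_units,
      FiniteField.natCard_extension, Nat.card_eq_fintype_card]
  let R : F[X] := (X - 1) * minpoly F (α : K)
  have hconj := H (Units.map ρ.toMonoidHom (MulEquiv.prodUnits.symm (α, 1)))
  have hR : aeval (α : K) R = 0 ∧ aeval (1 : F) R = 0 := by simp [R]
  have h0 := hconj.aeval_eq_zero (r := R) (by
    change aeval (ρ ((α : K), (1 : F))) R = 0
    rw [aeval_algHom_apply, aeval_prod_apply, hR.1, hR.2]
    exact map_zero ρ)
  rw [← map_pow] at h0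
  change aeval (ρ (((α : K), (1 : F)) ^ t)) R = 0 at h0
  rw [aeval_algHom_apply, aeval_prod_apply] at h0
  have h1 : aeval ((α : K) ^ t) R = 0 := hρ _ h0
  rw [map_mul, mul_eq_zero] at h1
  rcases h1 with h1 | h1
  · have h2 : α ^ t = 1 := Units.ext (by simpa [sub_eq_zero] using h1)
    have h3 : Fintype.card F ^ d - 1 = 1 :=
      Nat.eq_one_of_dvd_coprimes ht (hord ▸ orderOf_dvd_of_pow_eq_one h2) hM
    exact ⟨0, by rw [h3]; exact Nat.modEq_one⟩
  · obtain ⟨σ, hσ⟩ := isConjRoot_iff_exists_algEquiv.1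
      ((isConjRoot_iff_aeval_eq_zero (Algebra.IsIntegral.isIntegral (R := F) (α : K))).2 h1).symm
    obtain ⟨k, hk⟩ := FiniteField.exists_forall_apply_eq_pow F p K σ
    refine ⟨k, hord ▸ pow_eq_pow_iff_modEq.1 (Units.ext ?_)⟩
    rw [Units.val_pow_eq_pow_val, Units.val_pow_eq_pow_val, ← hσ, hk, Nat.card_eq_fintype_card]

end Polynomial

theorem Nat.not_pow_modEq_one_add_div {q d l : ℕ} (hq : 2 ≤ q) (hd : 1 ≤ d) (hl : l.Prime)
    (hN : l ^ 2 ∣ q ^ d - 1) (k : ℕ) : ¬ q ^ k ≡ 1 + (q ^ d - 1) / l [MOD q ^ d - 1] := by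
  intro h
  obtain ⟨x, hx⟩ : l ∣ q ^ d - 1 := (dvd_pow_self l two_ne_zero).trans hN
  rw [hx, Nat.mul_div_cancel_left x hl.pos, ← hx] at h
  have hlx : l ∣ x := by
    rw [hx, sq] at hN
    exact Nat.dvd_of_mul_dvd_mul_left hl.pos hN
  have hqd : 2 ≤ q ^ d := hq.trans (Nat.le_self_pow (by omega) q)
  have hx0 : 0 < x := Nat.pos_of_ne_zero fun h0 => by simp [h0] at hx; omega
  have hlx' : l ≤ x := Nat.le_of_dvd hx0 hlx
  have hl2 := hl.two_le
  have hred : q ^ k ≡ q ^ (k % d) [MOD q ^ d - 1] := by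
    conv_lhs => rw [← Nat.div_add_mod k d, pow_add, pow_mul]
    have h1 : q ^ d ≡ 1 [MOD q ^ d - 1] :=
      ((Nat.modEq_iff_dvd' (by omega)).2 dvd_rfl).symm
    simpa using (h1.pow (k / d)).mul_right (q ^ (k % d))
  have hkd : k % d < d := Nat.mod_lt _ hd
  generalize k % d = j at hred hkd
  obtain ⟨i, rfl⟩ := Nat.exists_eq_add_of_lt hkd
  rw [add_assoc, pow_add] at *
  have hP : 2 ≤ q ^ (i + 1) := hq.trans (Nat.le_self_pow (by omega) q)
  generalize q ^ (i + 1) = P at *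
  have hQ : 1 ≤ q ^ j := Nat.one_le_pow _ _ (by omega)
  generalize q ^ j = Q at *
  have hlt : 1 + x < Q * P - 1 := by
    rw [hx]; nlinarith
  have hQlt : Q < Q * P - 1 := by
    have : Q * 2 ≤ Q * P := Nat.mul_le_mul_left Q hP
    omega
  have hQx : Q = 1 + x := (hred.symm.trans h).eq_of_lt_of_lt hQlt hlt
  subst hQx
  obtain ⟨y, rfl⟩ := Nat.exists_eq_add_of_le hP
  have hlxy : l * x = x * (y + 1) + x + (y + 1) := by
    rw [← hx, Nat.sub_eq_iff_eq_add (by nlinarith)]; ring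
  have hxy : x ∣ y + 1 := by
    have h1 : x ∣ x * (y + 1) + x + (y + 1) := hlxy ▸ dvd_mul_left x l
    exact (Nat.dvd_add_right ((dvd_mul_right x _).add dvd_rfl)).1 h1
  have := Nat.le_of_dvd (by omega) hxy
  nlinarith

theorem CommGroup.exists_monoidHom_apply_ne_one_and_apply_ne_one {A : Type*} [CommGroup A]
    [Finite A] {a b : A} (ha : a ≠ 1) (hb : b ≠ 1) : ∃ χ : A →* ℂˣ, χ a ≠ 1 ∧ χ b ≠ 1 := by
  obtain ⟨χ, hχ⟩ := CommGroup.exists_apply_ne_one_of_hasEnoughRootsOfUnity A ℂ ha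
  obtain ⟨ψ, hψ⟩ := CommGroup.exists_apply_ne_one_of_hasEnoughRootsOfUnity A ℂ hb
  by_cases h1 : χ b = 1
  · by_cases h2 : ψ a = 1
    · exact ⟨χ * ψ, by simpa [h2], by simpa [h1]⟩
    · exact ⟨ψ, h2, hψ⟩
  · exact ⟨χ, hχ, h1⟩

theorem CommGroup.exists_monoidHom_forall_prime_apply_ne_one {A : Type*} [CommGroup A] [Finite A]
    (S : Finset ℕ) (hS : ∀ l ∈ S, l.Prime) (a b : ℕ → A)
    (ha : ∀ l ∈ S, orderOf (a l) = l) (hb : ∀ l ∈ S, orderOf (b l) = l) :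
    ∃ χ : A →* ℂˣ, ∀ l ∈ S, χ (a l) ≠ 1 ∧ χ (b l) ≠ 1 := by
  have hpow : ∀ {l u : ℕ} {x : A} (χ : A →* ℂˣ), l.Prime → orderOf x = l → χ x ≠ 1 → ¬ l ∣ u →
      χ x ^ u ≠ 1 := by
    intro l u x χ hl hx hχ hu h
    have h1 : orderOf (χ x) ∣ l := hx ▸ orderOf_map_dvd χ x
    have h2 : orderOf (χ x) = l :=
      ((Nat.dvd_prime hl).1 h1).resolve_left fun h => hχ (orderOf_eq_one_iff.1 h)
    exact hu (h2 ▸ orderOf_dvd_of_pow_eq_one h)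
  have hpow' : ∀ {l u : ℕ} {x : A} (χ : A →* ℂˣ), orderOf x = l → l ∣ u → χ x ^ u = 1 := by
    intro l u x χ hx hu
    rw [← map_pow, orderOf_dvd_iff_pow_eq_one.1 (hx ▸ hu), map_one]
  induction S using Finset.induction_on with
  | empty => exact ⟨1, by simp⟩
  | insert l S hl ih =>
    simp only [Finset.mem_insert, forall_eq_or_imp] at hS ha hb ⊢
    obtain ⟨χ, hχ⟩ := ih hS.2 ha.2 hb.2
    have hne : ∀ x, orderOf x = l → x ≠ (1 : A) := fun x hx h =>
      hS.1.one_lt.ne (by rw [← hx, h, orderOf_one])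
    obtain ⟨ψ, hψ⟩ := CommGroup.exists_monoidHom_apply_ne_one_and_apply_ne_one
      (hne _ ha.1) (hne _ hb.1)
    have hprod : ¬ l ∣ ∏ i ∈ S, i := fun h => by
      obtain ⟨i, hi, hli⟩ := (hS.1.prime.dvd_finsetProd_iff _).1 h
      exact hl ((Nat.prime_dvd_prime_iff_eq hS.1 (hS.2 i hi)).1 hli ▸ hi)
    have hnd : ∀ i ∈ S, ¬ i ∣ l := fun i hi h =>
      hl ((Nat.prime_dvd_prime_iff_eq (hS.2 i hi) hS.1).1 h ▸ hi)
    refine ⟨χ ^ l * ψ ^ ∏ i ∈ S, i, ⟨?_, ?_⟩, fun i hi => ⟨?_, ?_⟩⟩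
    · simpa [hpow' χ ha.1 dvd_rfl] using hpow ψ hS.1 ha.1 hψ.1 hprod
    · simpa [hpow' χ hb.1 dvd_rfl] using hpow ψ hS.1 hb.1 hψ.2 hprod
    · simpa [hpow' ψ (ha.2 i hi) (show i ∣ ∏ i ∈ S, i from Finset.dvd_prod_of_mem id hi)] using
        hpow χ (hS.2 i hi) (ha.2 i hi) (hχ i hi).1 (hnd i hi)
    · simpa [hpow' ψ (hb.2 i hi) (show i ∣ ∏ i ∈ S, i from Finset.dvd_prod_of_mem id hi)] using
        hpow χ (hS.2 i hi) (hb.2 i hi) (hχ i hi).2 (hnd i hi)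

theorem CommGroup.exists_monoidHom_apply_ne_one_of_prime_order {A : Type*} [CommGroup A] [Finite A]
    {t : A} (ht : t ≠ 1) (S : Finset ℕ) (hS : ∀ l ∈ S, l.Prime) (c : ℕ → A)
    (hc : ∀ l ∈ S, orderOf (c l) = l) :
    ∃ χ : A →* ℂˣ, χ t ≠ 1 ∧ ∀ l ∈ S, χ (c l) ≠ 1 := by
  classical
  let p := (orderOf t).minFac
  have hp : p.Prime := Nat.minFac_prime fun h => ht (orderOf_eq_one_iff.1 h)
  let t' := t ^ (orderOf t / p)
  have ht' : orderOf t' = p := orderOf_pow_orderOf_div (orderOf_pos t).ne' (Nat.minFac_dvd _)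
  obtain ⟨χ, hχ⟩ := CommGroup.exists_monoidHom_forall_prime_apply_ne_one (insert p S)
    (by simpa [hp] using hS) (fun l => if l ∈ S then c l else t') (fun l => if l = p then t' else c l)
    (fun l hl => by
      split_ifs with h
      · exact hc l h
      · rwa [(Finset.mem_insert.1 hl).resolve_right h])
    (fun l hl => by
      split_ifs with h
      · rwa [h]
      · exact hc l ((Finset.mem_insert.1 hl).resolve_left h))
  refine ⟨χ, fun h => ?_, fun l hl => ?_⟩
  · have := (hχ p (Finset.mem_insert_self _ _)).2
    simp [t', h] at this
  · simpa [hl] using (hχ l (Finset.mem_insert_of_mem hl)).1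

open AddChar ZMod in
theorem DirichletCharacter.eq_zero_of_gaussSum_mulShift {N : ℕ} [NeZero N]
    (χ : DirichletCharacter ℂ N) (h0 : gaussSum χ stdAddChar = 0)
    (hχ : ∀ l : ℕ, l.Prime → l ^ 2 ∣ N → ∃ u : (ZMod N)ˣ, (u : ZMod N) = 1 + (N / l : ℕ) ∧ χ u ≠ 1)
    (a : ℕ) : gaussSum χ (stdAddChar.mulShift (a : ZMod N)) = 0 := by
  have hunit : ∀ (ψ : AddChar (ZMod N) ℂ) (u : (ZMod N)ˣ), gaussSum χ ψ = 0 →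
      gaussSum χ (ψ.mulShift (u : ZMod N)) = 0 := by
    intro ψ u h
    rw [gaussSum_mulShift_eq, h, mul_zero]
  induction hn : (a.gcd N).primeFactors.card using Nat.strong_induction_on generalizing a with
  | h n ih =>
  have hN : N ≠ 0 := NeZero.ne N
  by_cases hg : a.gcd N = 1
  · rw [← ZMod.coe_unitOfCoprime a hg]
    exact hunit _ _ h0
  obtain ⟨l, hl, hlg⟩ := Nat.exists_prime_and_dvd hg
  have hla := hlg.trans (Nat.gcd_dvd_left a N)
  obtain ⟨n', hn'⟩ := hlg.trans (Nat.gcd_dvd_right a N)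
  have hdiv : N / l = n' := by rw [hn', Nat.mul_div_cancel_left _ hl.pos]
  by_cases hl2 : l ^ 2 ∣ N
  · obtain ⟨u, hu, hχu⟩ := hχ l hl hl2
    have hau : (u : ZMod N) * a = a := by
      obtain ⟨b, rfl⟩ := hla
      have : ((N / l * (l * b) : ℕ) : ZMod N) = 0 := by
        rw [ZMod.natCast_eq_zero_iff, hdiv, hn']
        exact ⟨b, by ring⟩
      rw [hu, add_mul, one_mul, ← Nat.cast_mul, this, add_zero]
    have h1 := gaussSum_mulShift χ (stdAddChar.mulShift (a : ZMod N)) u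
    rw [mulShift_mulShift, mul_comm (a : ZMod N), hau] at h1
    exact (mul_left_eq_self₀.1 h1).resolve_left hχu
  · have hln : ¬ l ∣ n' := fun ⟨c, hc⟩ => hl2 ⟨c, by rw [hn', hc]; ring⟩
    have hsum : ∑ j ∈ Finset.range l, gaussSum χ (stdAddChar.mulShift ((a + j * n' : ℕ) : ZMod N)) =
        0 := by
      simp only [gaussSum]
      rw [Finset.sum_comm]
      refine Finset.sum_eq_zero fun r _ => ?_
      by_cases hr : IsUnit r
      · have hx : ∀ j : ℕ, χ r * stdAddChar.mulShift ((a + j * n' : ℕ) : ZMod N) r =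
            χ r * stdAddChar ((a : ZMod N) * r) * stdAddChar ((n' : ZMod N) * r) ^ j := by
          intro j
          rw [mulShift_apply, ← map_nsmul_eq_pow, mul_assoc, ← map_add_eq_mul]
          congr 2
          push_cast
          simp only [nsmul_eq_mul]
          ring
        have hne : stdAddChar ((n' : ZMod N) * r) ≠ 1 := by
          rw [← map_zero_eq_one (stdAddChar (N := N))]
          refine injective_stdAddChar.ne fun h => ?_
          rw [hr.mul_left_eq_zero, ZMod.natCast_eq_zero_iff] at h
          have hn0 : n' ≠ 0 := by rintro rfl; simp at hn'; exact hN hn'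
          have := Nat.le_of_dvd (Nat.pos_of_ne_zero hn0) h
          have h2 := hl.two_le
          have := Nat.pos_of_ne_zero hn0
          nlinarith
        have hpow : stdAddChar ((n' : ZMod N) * r) ^ l = 1 := by
          rw [← map_nsmul_eq_pow, nsmul_eq_mul, ← mul_assoc, ← Nat.cast_mul, ← hn',
            ZMod.natCast_self, zero_mul, map_zero_eq_one]
        simp only [hx]
        rw [← Finset.mul_sum, geom_sum_eq hne, hpow, sub_self, zero_div, mul_zero]
      · simp [χ.map_nonunit hr]
    rw [Finset.sum_eq_single 0] at hsum
    · simpa using hsum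
    · intro j hj hj0
      refine ih _ ?_ _ rfl
      rw [← hn]
      refine Finset.card_lt_card (Finset.ssubset_iff_of_subset ?_ |>.2 ⟨l, ?_, ?_⟩)
      · intro l' hl'
        have hp := Nat.prime_of_mem_primeFactors hl'
        have h1 := Nat.dvd_of_mem_primeFactors hl'
        have hN' := h1.trans (Nat.gcd_dvd_right _ _)
        have ha' := h1.trans (Nat.gcd_dvd_left _ _)
        refine Nat.mem_primeFactors.2 ⟨hp, Nat.dvd_gcd ?_ hN', (Nat.gcd_pos_of_pos_right _
          (Nat.pos_of_ne_zero hN)).ne'⟩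
        by_cases hll : l' = l
        · exact hll ▸ hla
        · have : l' ∣ n' := ((hp.dvd_mul.1 (hn' ▸ hN')).resolve_left
            fun h => hll ((Nat.prime_dvd_prime_iff_eq hp hl).1 h))
          exact (Nat.dvd_add_left (this.mul_left j)).1 ha'
      · exact Nat.mem_primeFactors.2 ⟨hl, hlg, (Nat.gcd_pos_of_pos_right _
          (Nat.pos_of_ne_zero hN)).ne'⟩
      · intro h
        have h1 := (Nat.dvd_of_mem_primeFactors h).trans (Nat.gcd_dvd_left _ _)
        rcases hl.dvd_mul.1 ((Nat.dvd_add_right hla).1 h1) with h | h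
        · exact absurd (Nat.le_of_dvd (Nat.pos_of_ne_zero hj0) h)
            (not_le.2 (Finset.mem_range.1 hj))
        · exact hln h
    · exact fun h => absurd (Finset.mem_range.2 hl.pos) h

open AddChar ZMod in
theorem DirichletCharacter.gaussSum_stdAddChar_ne_zero {N : ℕ} [NeZero N]
    (χ : DirichletCharacter ℂ N)
    (hχ : ∀ l : ℕ, l.Prime → l ^ 2 ∣ N →
      ∃ u : (ZMod N)ˣ, (u : ZMod N) = 1 + (N / l : ℕ) ∧ χ u ≠ 1) :
    gaussSum χ stdAddChar ≠ 0 := by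
  intro h0
  have h1 : ZMod.dft (χ : ZMod N → ℂ) = 0 := by
    ext k
    obtain ⟨a, ha⟩ := ZMod.natCast_zmod_surjective (-k)
    rw [DirichletCharacter.fourierTransform_eq_gaussSum_mulShift, ← ha,
      χ.eq_zero_of_gaussSum_mulShift h0 hχ, Pi.zero_apply]
  have h2 := congrFun ((LinearEquiv.map_eq_zero_iff _).1 h1) 1
  simp at h2

open ZMod in
/-- If the Gaussian periods attached to the subgroup generated by `q` are invariant under
multiplication by `t`, then `t` is in this subgroup. -/
theorem ZMod.mem_zpowers_of_forall_sum_stdAddChar_eq {N d : ℕ} [NeZero N] (hd : d ≠ 0)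
    {q t : (ZMod N)ˣ}
    (hq : ∀ l : ℕ, l.Prime → l ^ 2 ∣ N → ∀ u ∈ Subgroup.zpowers q,
      (u : ZMod N) ≠ 1 + (N / l : ℕ))
    (h : ∀ r : (ZMod N)ˣ, ∑ k ∈ Finset.range d, stdAddChar (r * q ^ k : ZMod N) =
      ∑ k ∈ Finset.range d, stdAddChar (r * t * q ^ k : ZMod N)) :
    t ∈ Subgroup.zpowers q := by
  by_contra ht
  have hex : ∀ l : ℕ, ∃ u : (ZMod N)ˣ, l.Prime → l ^ 2 ∣ N →
      (u : ZMod N) = 1 + (N / l : ℕ) ∧ u ^ l = 1 := by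
    intro l
    by_cases hl : l.Prime ∧ l ^ 2 ∣ N
    · obtain ⟨c, hc⟩ := hl.2
      have hNl : N / l = l * c := by
        rw [hc, sq, mul_assoc, Nat.mul_div_cancel_left _ hl.1.pos]
      set x : ZMod N := ((N / l : ℕ) : ZMod N) with hx
      have hxx : x * x = 0 := by
        rw [hx, ← Nat.cast_mul, ZMod.natCast_eq_zero_iff, hNl]
        exact ⟨c, by nth_rewrite 1 [hc]; ring⟩
      have hlx : (l : ZMod N) * x = 0 := by
        rw [hx, ← Nat.cast_mul, ZMod.natCast_eq_zero_iff, hNl]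
        exact ⟨1, by nth_rewrite 1 [hc]; ring⟩
      have hpow : ∀ j : ℕ, (1 + x) ^ j = 1 + j * x := by
        intro j
        induction j with
        | zero => simp
        | succ j ih =>
          rw [pow_succ, ih]
          push_cast
          linear_combination (j : ZMod N) * hxx
      have h1 : (1 + x) ^ l = 1 := by rw [hpow, hlx, add_zero]
      exact ⟨Units.ofPowEqOne _ l h1 hl.1.ne_zero, fun _ _ => ⟨rfl, Units.ext h1⟩⟩
    · exact ⟨1, fun h1 h2 => absurd ⟨h1, h2⟩ hl⟩
  choose c hc using hex
  let π := QuotientGroup.mk' (Subgroup.zpowers q)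
  have hπ : ∀ u, π u = 1 ↔ u ∈ Subgroup.zpowers q := fun u => by
    rw [← MonoidHom.mem_ker, QuotientGroup.ker_mk']
  let S := N.divisors.filter fun l => l.Prime ∧ l ^ 2 ∣ N
  have hS : ∀ l, l ∈ S ↔ l.Prime ∧ l ^ 2 ∣ N := by
    intro l
    simp only [S, Finset.mem_filter, Nat.mem_divisors, and_iff_right_iff_imp]
    exact fun hl => ⟨(dvd_pow_self l two_ne_zero).trans hl.2, NeZero.ne N⟩
  obtain ⟨χ₀, hχt, hχc⟩ := CommGroup.exists_monoidHom_apply_ne_one_of_prime_order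
    (t := π t) (fun h => ht ((hπ t).1 h)) S (fun l hl => ((hS l).1 hl).1)
    (fun l => π (c l)) (fun l hl => by
      obtain ⟨h1, h2⟩ := (hS l).1 hl
      obtain ⟨h3, h4⟩ := hc l h1 h2
      have := Fact.mk h1
      refine orderOf_eq_prime (by rw [← map_pow, h4, map_one]) fun h => ?_
      exact hq l h1 h2 _ ((hπ _).1 h) h3)
  let χ : DirichletCharacter ℂ N := MulChar.ofUnitHom (χ₀.comp π)
  have hval : ∀ u : (ZMod N)ˣ, χ u = χ₀ (π u) := fun u => MulChar.ofUnitHom_coe _ u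
  have hχq : χ q = 1 := by
    rw [hval, (hπ q).2 (Subgroup.mem_zpowers q), map_one, Units.val_one]
  refine χ.gaussSum_stdAddChar_ne_zero (fun l hl hl2 => ⟨c l, (hc l hl hl2).1, fun h => ?_⟩) ?_
  · rw [hval] at h
    exact hχc l ((hS l).2 ⟨hl, hl2⟩) (Units.ext h)
  have hshift : ∀ s : (ZMod N)ˣ, ∑ r : ZMod N, χ r * ∑ k ∈ Finset.range d,
      stdAddChar (r * s * q ^ k : ZMod N) = d * (χ⁻¹ s * gaussSum χ stdAddChar) := by
    intro s
    simp only [Finset.mul_sum]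
    rw [Finset.sum_comm, Finset.sum_congr rfl (g := fun _ => χ⁻¹ s * gaussSum χ stdAddChar)]
    · simp
    · intro k _
      have h1 := gaussSum_mulShift_eq χ (stdAddChar (N := N)) (s * q ^ k)
      have h2 : χ⁻¹ (s * q ^ k : (ZMod N)ˣ) = χ⁻¹ s := by
        rw [Units.val_mul, Units.val_pow_eq_pow_val, map_mul, map_pow, MulChar.inv_apply_eq_inv' χ q,
          hχq, inv_one, one_pow, mul_one]
      rw [h2] at h1
      rw [← h1, gaussSum]
      refine Finset.sum_congr rfl fun r _ => ?_
      rw [AddChar.mulShift_apply, Units.val_mul, Units.val_pow_eq_pow_val]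
      ring_nf
  have heq : ∑ r : ZMod N, χ r * ∑ k ∈ Finset.range d,
      stdAddChar (r * (1 : (ZMod N)ˣ) * q ^ k : ZMod N) =
      ∑ r : ZMod N, χ r * ∑ k ∈ Finset.range d, stdAddChar (r * t * q ^ k : ZMod N) := by
    refine Finset.sum_congr rfl fun r _ => ?_
    by_cases hr : IsUnit r
    · obtain ⟨u, rfl⟩ := hr
      rw [← h u]
      simp
    · rw [χ.map_nonunit hr, zero_mul, zero_mul]
  rw [hshift, hshift] at heq
  have h3 := mul_left_cancel₀ (Nat.cast_ne_zero.2 hd) heq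
  by_contra hτ
  have h4 := mul_right_cancel₀ hτ h3
  rw [Units.val_one, map_one, MulChar.inv_apply_eq_inv', hval] at h4
  exact hχt (Units.ext (inv_eq_one.1 h4.symm))

theorem zeta_pow_self {N : ℕ} (hN : N ≠ 0) : zeta N ^ N = 1 :=
  (Complex.isPrimitiveRoot_exp N hN).pow_eq_one

theorem zeta_pow_eq_stdAddChar (N j : ℕ) [NeZero N] :
    zeta N ^ j = ZMod.stdAddChar (j : ZMod N) := by
  rw [zeta, ← Complex.exp_nat_mul, ← Int.cast_natCast (R := ZMod N) j, ZMod.stdAddChar_coe]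
  congr 1
  push_cast
  ring

theorem exists_modEq_pow_of_forall_sum_zeta_eq {q d t : ℕ} (hq : 2 ≤ q) (hd : 1 ≤ d)
    (ht : t.Coprime (q ^ d - 1))
    (h : ∀ r : ℕ, r.Coprime (q ^ d - 1) → ∑ k ∈ Finset.range d, zeta (q ^ d - 1) ^ (r * q ^ k) =
      ∑ k ∈ Finset.range d, zeta (q ^ d - 1) ^ (r * t * q ^ k)) :
    ∃ k, t ≡ q ^ k [MOD q ^ d - 1] := by
  have hqd : 2 ≤ q ^ d := hq.trans (Nat.le_self_pow (by omega) q)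
  have : NeZero (q ^ d - 1) := ⟨by omega⟩
  have hqN : q.Coprime (q ^ d - 1) := by
    refine Nat.Coprime.coprime_dvd_left (dvd_pow_self q (by omega : d ≠ 0)) ?_
    exact (Nat.coprime_self_sub_right (one_le_two.trans hqd)).2 (Nat.coprime_one_right _)
  have hpow : ∀ u ∈ Subgroup.zpowers (ZMod.unitOfCoprime q hqN), ∃ k : ℕ,
      (u : ZMod (q ^ d - 1)) = (q ^ k : ℕ) := by
    intro u hu
    obtain ⟨k, rfl⟩ := Submonoid.mem_powers_iff _ _ |>.1 (mem_powers_iff_mem_zpowers.2 hu)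
    exact ⟨k, by simp⟩
  have hmem : ZMod.unitOfCoprime t ht ∈ Subgroup.zpowers (ZMod.unitOfCoprime q hqN) := by
    refine ZMod.mem_zpowers_of_forall_sum_stdAddChar_eq (d := d) (by omega) ?_ fun r => ?_
    · intro l hl hl2 u hu huv
      obtain ⟨k, hk⟩ := hpow u hu
      refine Nat.not_pow_modEq_one_add_div hq hd hl hl2 k ?_
      rw [← ZMod.natCast_eq_natCast_iff, ← hk, huv]
      push_cast
      rfl
    · have h1 := h _ (ZMod.val_coe_unit_coprime r)
      simpa [zeta_pow_eq_stdAddChar] using h1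
  obtain ⟨k, hk⟩ := hpow _ hmem
  exact ⟨k, (ZMod.natCast_eq_natCast_iff _ _ _).1 (by simpa using hk)⟩

theorem Finset.sum_range_add_eq_sum_range_of_periodic {R : Type*} [AddCommMonoid R] {f : ℕ → R}
    {d : ℕ} (hf : Function.Periodic f d) (k : ℕ) :
    ∑ i ∈ Finset.range d, f (i + k) = ∑ i ∈ Finset.range d, f i := by
  induction k with
  | zero => rfl
  | succ k ih =>
    rw [← ih]
    cases d with
    | zero => rfl
    | succ d =>
      rw [Finset.sum_range_succ, Finset.sum_range_succ' (fun i => f (i + k))]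
      congr 1
      · exact Finset.sum_congr rfl fun i _ => by congr 1; ring
      · rw [← hf (0 + k)]
        congr 1; ring

theorem IntermediateField.adjoin_le_adjoin_of_forall_algEquiv {F L : Type*} [Field F] [Field L]
    [Algebra F L] (E : IntermediateField F L) [FiniteDimensional F E] [IsGalois F E] {S T : Set L}
    (hT : T ⊆ E)
    (h : ∀ σ : Gal(E/F), (∀ x : E, (x : L) ∈ S → σ x = x) → ∀ x : E, (x : L) ∈ T → σ x = x) :
    adjoin F T ≤ adjoin F S := by
  rw [adjoin_le_iff]
  intro y hy
  let K : IntermediateField F E := adjoin F (E.val ⁻¹' S)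
  have hyK : (⟨y, hT hy⟩ : E) ∈ K := by
    rw [← IsGalois.fixedField_fixingSubgroup K]
    rintro ⟨σ, hσ⟩
    exact h σ (fun x hx => hσ ⟨x, subset_adjoin F _ hx⟩) ⟨y, hT hy⟩ hy
  have hmap : K.map E.val ≤ adjoin F S := by
    rw [adjoin_map]
    exact adjoin.mono _ _ _ (Set.image_preimage_subset _ _)
  exact hmap ⟨_, hyK, rfl⟩

theorem IsPrimitiveRoot.exists_coprime_forall_map_eq_pow {R : Type*} [CommRing R] [IsDomain R]
    {M : ℕ} [NeZero M] {ζ : R} (hζ : IsPrimitiveRoot ζ M) (σ : R ≃+* R) :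
    ∃ t : ℕ, t.Coprime M ∧ ∀ x : R, x ^ M = 1 → σ x = x ^ t := by
  obtain ⟨t, -, ht, h⟩ := hζ.isPrimitiveRoot_iff.1 (hζ.map_of_injective σ.injective)
  refine ⟨t, ht, fun x hx => ?_⟩
  obtain ⟨i, -, rfl⟩ := hζ.eq_pow_of_pow_eq_one hx
  rw [map_pow, ← h, pow_right_comm]

theorem IntermediateField.coe_map_eq_sum_pow {F L : Type*} [Field F] [Field L] [Algebra F L]
    {E : IntermediateField F L} {M t : ℕ} (hE : ∀ z : L, z ^ M = 1 → z ∈ E) (σ : Gal(E/F))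
    (hσ : ∀ x : E, x ^ M = 1 → σ x = x ^ t) {ι : Type*} (s : Finset ι) (c : ι → ℕ) (z : ι → L)
    (hz : ∀ i, z i ^ M = 1) {x : E} (hx : (x : L) = ∑ i ∈ s, (c i : L) * z i) :
    (σ x : L) = ∑ i ∈ s, (c i : L) * z i ^ t := by
  let w : ι → E := fun i => ⟨z i, hE _ (hz i)⟩
  have hw : ∀ i, σ (w i) = w i ^ t := fun i => hσ _ (Subtype.ext (hz i))
  have hxw : x = ∑ i ∈ s, (c i : E) * w i := Subtype.ext (by simp [hx, w])
  rw [hxw, map_sum]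
  simp [hw, w]

theorem IntermediateField.coe_map_trace_eq_trace_pow {V : Type*} [AddCommGroup V] [Module ℂ V]
    [FiniteDimensional ℂ V] {A : Module.End ℂ V} {E : IntermediateField ℚ ℂ} {M t : ℕ} (hM : M ≠ 0)
    (hA : A ^ M = 1) (hE : ∀ z : ℂ, z ^ M = 1 → z ∈ E) (σ : Gal(E/ℚ))
    (hσ : ∀ x : E, x ^ M = 1 → σ x = x ^ t) {x : E} (hx : (x : ℂ) = LinearMap.trace ℂ V A) :
    (σ x : ℂ) = LinearMap.trace ℂ V (A ^ t) := by
  obtain ⟨ι, _, z, c, hz, htr⟩ := LinearMap.exists_trace_pow_eq_sum A hM hA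
  rw [htr]
  refine coe_map_eq_sum_pow hE σ hσ Finset.univ c z hz ?_
  simpa [hx] using htr 1

theorem IntermediateField.trace_mem_of_pow_eq_one {V : Type*} [AddCommGroup V] [Module ℂ V]
    [FiniteDimensional ℂ V] {A : Module.End ℂ V} {E : IntermediateField ℚ ℂ} {M : ℕ} (hM : M ≠ 0)
    (hA : A ^ M = 1) (hE : ∀ z : ℂ, z ^ M = 1 → z ∈ E) : LinearMap.trace ℂ V A ∈ E := by
  obtain ⟨ι, _, z, c, hz, htr⟩ := LinearMap.exists_trace_pow_eq_sum A hM hA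
  have h1 := htr 1
  simp only [pow_one] at h1
  rw [h1]
  exact sum_mem fun i _ => mul_mem (natCast_mem E _) (hE _ (hz i))

theorem FDRep.rho_pow_eq_one {G : Type} [Group G] (V : FDRep ℂ G) {g : G} {M : ℕ}
    (hg : g ^ M = 1) : V.ρ g ^ M = 1 := by
  rw [← map_pow, hg, map_one]

theorem zeta_periodic {q d : ℕ} (hq : 1 ≤ q) (r : ℕ) (hN : q ^ d - 1 ≠ 0) :
    Function.Periodic (fun k => zeta (q ^ d - 1) ^ (r * q ^ k)) d := by
  intro k
  refine pow_eq_pow_of_modEq_of_pow_eq_one (zeta_pow_self hN) (Nat.ModEq.mul_left r ?_)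
  have h1 : q ^ d ≡ 1 [MOD q ^ d - 1] :=
    ((Nat.modEq_iff_dvd' (Nat.one_le_pow _ _ hq)).2 dvd_rfl).symm
  simpa [pow_add] using h1.mul_left (q ^ k)

/-- For `q = p^n` a prime power and `m ≥ 2`,
`K(GL_m(F_q)) = ℚ({ω_d(r) : 1 ≤ d ≤ m, r ∈ (ℤ/(q^d − 1)ℤ)^×})`, where
`ω_d(r) = Σ_{k=0}^{d−1} ζ_{q^d−1}^{r q^k}`. -/
theorem statement0 (p n m q : ℕ) (hp : p.Prime) (hn : 1 ≤ n) (hm : 2 ≤ m)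
    (hq : q = p ^ n) (F : Type) [Field F] [Fintype F] (hF : Fintype.card F = q) :
    charField (GL (Fin m) F) =
      IntermediateField.adjoin ℚ
        {x : ℂ | ∃ d r : ℕ, 1 ≤ d ∧ d ≤ m ∧ Nat.Coprime r (q ^ d - 1) ∧
          x = ∑ k ∈ Finset.range d, zeta (q ^ d - 1) ^ (r * q ^ k)} := by
  have hq2 : 2 ≤ q := hF ▸ Fintype.one_lt_card
  have hN0 : ∀ d, 1 ≤ d → q ^ d - 1 ≠ 0 := fun d hd => by
    have := hq2.trans (Nat.le_self_pow (by omega : d ≠ 0) q)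
    omega
  let M := Nat.card (GL (Fin m) F) * ∏ d ∈ Finset.Icc 1 m, (q ^ d - 1)
  have hM : M ≠ 0 := mul_ne_zero Nat.card_pos.ne' <| Finset.prod_ne_zero_iff.2 fun d hd =>
    hN0 d (Finset.mem_Icc.1 hd).1
  have hMd : ∀ d, 1 ≤ d → d ≤ m → q ^ d - 1 ∣ M := fun d h1 h2 =>
    (Finset.dvd_prod_of_mem (fun d => q ^ d - 1) (Finset.mem_Icc.2 ⟨h1, h2⟩)).mul_left _
  have hMg : ∀ g : GL (Fin m) F, g ^ M = 1 := fun g =>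
    orderOf_dvd_iff_pow_eq_one.1 ((orderOf_dvd_natCard g).mul_right _)
  have hMz : ∀ d, 1 ≤ d → d ≤ m → ∀ r k, (zeta (q ^ d - 1) ^ (r * q ^ k)) ^ M = 1 := by
    intro d h1 h2 r k
    obtain ⟨c, hc⟩ := hMd d h1 h2
    rw [pow_right_comm, hc, pow_mul _ _ c, zeta_pow_self (hN0 d h1), one_pow, one_pow]
  have := NeZero.mk hM
  let E : IntermediateField ℚ ℂ :=
    IntermediateField.adjoin ℚ {b : ℂ | ∃ n ∈ ({M} : Set ℕ), n ≠ 0 ∧ b ^ n = 1}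
  have hE : ∀ z : ℂ, z ^ M = 1 → z ∈ E := fun z hz =>
    IntermediateField.subset_adjoin _ _ ⟨M, rfl, hM, hz⟩
  have : IsCyclotomicExtension {M} ℚ E :=
    IntermediateField.isCyclotomicExtension_adjoin_of_exists_isPrimitiveRoot {M} ℚ ℂ
      fun n _ hn => ⟨_, Complex.isPrimitiveRoot_exp n hn⟩
  have : @IsGalois ℚ _ E _ E.algebra' := IsCyclotomicExtension.isGalois {M} ℚ E
  have : FiniteDimensional ℚ E := IsCyclotomicExtension.finiteDimensional {M} ℚ E
  have hσ : ∀ σ : Gal(E/ℚ), ∃ t : ℕ, t.Coprime M ∧ ∀ x : E, x ^ M = 1 → σ x = x ^ t := fun σ =>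
    (IsCyclotomicExtension.zeta_spec M ℚ E).exists_coprime_forall_map_eq_pow σ.toRingEquiv
  have hchar : ∀ (V : FDRep ℂ (GL (Fin m) F)) (g : GL (Fin m) F), V.character g ∈ E := fun V g =>
    IntermediateField.trace_mem_of_pow_eq_one hM (V.rho_pow_eq_one (hMg g)) hE
  have hcharσ : ∀ (σ : Gal(E/ℚ)) (t : ℕ), (∀ x : E, x ^ M = 1 → σ x = x ^ t) →
      ∀ (V : FDRep ℂ (GL (Fin m) F)) (g : GL (Fin m) F) (x : E), (x : ℂ) = V.character g →
        (σ x : ℂ) = V.character (g ^ t) := by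
    intro σ t ht V g x hx
    rw [IntermediateField.coe_map_trace_eq_trace_pow hM (V.rho_pow_eq_one (hMg g)) hE σ ht hx,
      ← map_pow]
    rfl
  have hω : ∀ d, 1 ≤ d → d ≤ m → ∀ r,
      ∑ k ∈ Finset.range d, zeta (q ^ d - 1) ^ (r * q ^ k) ∈ E := fun d h1 h2 r =>
    sum_mem fun k _ => hE _ (hMz d h1 h2 r k)
  have hωσ : ∀ (σ : Gal(E/ℚ)) (t : ℕ), (∀ x : E, x ^ M = 1 → σ x = x ^ t) →
      ∀ d, 1 ≤ d → d ≤ m → ∀ (r : ℕ) (x : E),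
        (x : ℂ) = ∑ k ∈ Finset.range d, zeta (q ^ d - 1) ^ (r * q ^ k) →
        (σ x : ℂ) = ∑ k ∈ Finset.range d, zeta (q ^ d - 1) ^ (r * t * q ^ k) := by
    intro σ t ht d h1 h2 r x hx
    refine (IntermediateField.coe_map_eq_sum_pow hE σ ht (Finset.range d) (fun _ => 1) _
      (hMz d h1 h2 r) (by simpa using hx)).trans (Finset.sum_congr rfl fun k _ => ?_)
    rw [Nat.cast_one, one_mul, ← pow_mul]
    ring_nf
  refine le_antisymm
    (IntermediateField.adjoin_le_adjoin_of_forall_algEquiv E ?_ fun σ hfix => ?_)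
    (IntermediateField.adjoin_le_adjoin_of_forall_algEquiv E ?_ fun σ hfix => ?_)
  · rintro _ ⟨V, -, g, rfl⟩
    exact hchar V g
  · obtain ⟨t, htM, ht⟩ := hσ σ
    rintro x ⟨V, -, g, hg⟩
    have hconj : IsConj g (g ^ t) := by
      refine Matrix.GeneralLinearGroup.isConj_pow g hM (hMg g) htM fun d h1 h2 => ?_
      rw [hF]
      refine exists_modEq_pow_of_forall_sum_zeta_eq hq2 h1
        (htM.coprime_dvd_right (hMd d h1 h2)) fun r hr => ?_
      exact (congrArg Subtype.val (hfix ⟨_, hω d h1 h2 r⟩ ⟨d, r, h1, h2, hr, rfl⟩)).symm.trans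
        (hωσ σ t ht d h1 h2 r _ rfl)
    obtain ⟨c, hc⟩ := isConj_iff.1 hconj
    refine Subtype.ext ((hcharσ σ t ht V g x hg.symm).trans ?_)
    rw [← hc, FDRep.char_conj, hg]
  · rintro _ ⟨d, r, h1, h2, -, rfl⟩
    exact hω d h1 h2 r
  · obtain ⟨t, htM, ht⟩ := hσ σ
    rintro x ⟨d, r, h1, h2, -, hx⟩
    obtain ⟨j, hj⟩ : ∃ j, t ≡ q ^ j [MOD q ^ d - 1] := by
      rw [← hF]
      refine exists_modEq_card_pow_of_isConj_pow htM h1 h2 (hF ▸ hMd d h1 h2) fun g =>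
        isConj_of_forall_character_eq fun V hV => ?_
      exact (congrArg Subtype.val (hfix ⟨_, hchar V g⟩ ⟨V, hV, g, rfl⟩)).symm.trans
        (hcharσ σ t ht V g _ rfl)
    refine Subtype.ext ((hωσ σ t ht d h1 h2 r x hx).trans ?_)
    rw [hx, ← Finset.sum_range_add_eq_sum_range_of_periodic
      (zeta_periodic (by omega) r (hN0 d h1)) j]
    refine Finset.sum_congr rfl fun k _ => ?_
    refine pow_eq_pow_of_modEq_of_pow_eq_one (zeta_pow_self (hN0 d h1)) ?_
    rw [mul_assoc, pow_add, mul_comm (q ^ k)]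
    exact (hj.mul_right _).mul_left _
end

section
/- Let p be a prime, q = p^n, m ≥ 2, and let ℓ ≠ p be an odd prime and r ≥ 1 an integer such that GL_m(F_q) contains an element of order ℓ^r. Then K_{ℓ^r}(GL_m(F_q)) is a subfield of the cyclotomic field ℚ(ζ_{ℓ^r}) of degree ℓ^{r−1}(ℓ−1)/ord_{ℓ^r}(q) over ℚ, where ord_{ℓ^r}(q) denotes the multiplicative order of q modulo ℓ^r. -/
open CategoryTheory

lemma isSemisimple_of_pow_eq_one {k : Type*} [Field k] {V : Type*} [AddCommGroup V] [Module k V]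
    {R : Module.End k V} {N : ℕ} (hN : (N : k) ≠ 0) (hR : R ^ N = 1) : R.IsSemisimple := by
  refine Module.End.isSemisimple_of_squarefree_aeval_eq_zero
    (p := Polynomial.X ^ N - Polynomial.C 1) ?_ (by simp [hR])
  exact (Polynomial.separable_X_pow_sub_C (1 : k) hN one_ne_zero).squarefree

lemma trace_restrict_eq_mul_trace_restrict {V : Type*} [AddCommGroup V]
    [Module ℂ V] {A B : Module.End ℂ V} {p : Submodule ℂ V}
    (hA : ∀ v ∈ p, A v ∈ p) (hB : ∀ v ∈ p, B v ∈ p) {c : ℂ} (h : ∀ v ∈ p, A v = c • B v) :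
    LinearMap.trace ℂ p (A.restrict hA) = c * LinearMap.trace ℂ p (B.restrict hB) := by
  have hrestrict : A.restrict hA = c • B.restrict hB := by
    ext ⟨v, hv⟩
    exact h v hv
  rw [hrestrict, map_smul, smul_eq_mul]

section TraceDecomposition

variable {V : Type*} [AddCommGroup V] [Module ℂ V] [FiniteDimensional ℂ V]

/-- The trace of `B * R ^ j`, where `R` has finite order and commutes with `B`, decomposes along
the eigenspaces of `R`. -/
lemma exists_trace_mul_pow_eq_sum {R : Module.End ℂ V} {N : ℕ} (hN : N ≠ 0) (hR : R ^ N = 1) :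
    ∃ s : Finset ℂ, (∀ μ ∈ s, μ ^ N = 1) ∧ ∀ (B : Module.End ℂ V) (hB : Commute R B) (j : ℕ),
      LinearMap.trace ℂ V (B * R ^ j) = ∑ μ ∈ s, μ ^ j *
        LinearMap.trace ℂ (R.eigenspace μ)
          (B.restrict (Module.End.mapsTo_genEigenspace_of_comm hB μ 1)) := by
  have hss := isSemisimple_of_pow_eq_one (Nat.cast_ne_zero.mpr hN) hR
  have hintl := DirectSum.isInternal_submodule_of_iSupIndep_of_iSup_eq_top
    R.eigenspaces_iSupIndep hss.iSup_eigenspace_eq_top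
  have hfin : {μ | R.eigenspace μ ≠ ⊥}.Finite :=
    WellFoundedGT.finite_ne_bot_of_iSupIndep R.eigenspaces_iSupIndep
  have hpow (μ : ℂ) (v : V) (hv : v ∈ R.eigenspace μ) (j : ℕ) : (R ^ j) v = μ ^ j • v := by
    rw [Module.End.mem_eigenspace_iff] at hv
    induction j with
    | zero => simp
    | succ j ih => rw [pow_succ, Module.End.mul_apply, hv, map_smul, ih, smul_smul, pow_succ']
  refine ⟨hfin.toFinset, fun μ hμ ↦ ?_, fun B hB j ↦ ?_⟩
  · obtain ⟨v, hv, hv0⟩ := Submodule.exists_mem_ne_zero_of_ne_bot (by simpa using hμ)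
    have h := hpow μ v hv N
    rw [hR, Module.End.one_apply] at h
    have : (μ ^ N - 1) • v = 0 := by rw [sub_smul, ← h, one_smul, sub_self]
    exact sub_eq_zero.mp ((smul_eq_zero.mp this).resolve_right hv0)
  · have hmaps (μ : ℂ) : Set.MapsTo (B * R ^ j) (R.eigenspace μ) (R.eigenspace μ) :=
      Module.End.mapsTo_genEigenspace_of_comm (hB.mul_right ((Commute.refl R).pow_right j)) μ 1
    rw [LinearMap.trace_eq_sum_trace_restrict' hintl hfin hmaps]
    refine Finset.sum_congr rfl fun μ _ ↦ ?_
    exact trace_restrict_eq_mul_trace_restrict _ _ fun v hv ↦ by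
      rw [Module.End.mul_apply, hpow μ v hv j, map_smul]

lemma exists_trace_pow_eq_sum {R : Module.End ℂ V} {N : ℕ} (hN : N ≠ 0) (hR : R ^ N = 1) :
    ∃ (s : Finset ℂ) (d : ℂ → ℕ), (∀ μ ∈ s, μ ^ N = 1) ∧
      ∀ j : ℕ, LinearMap.trace ℂ V (R ^ j) = ∑ μ ∈ s, μ ^ j * d μ := by
  obtain ⟨s, hs, h⟩ := exists_trace_mul_pow_eq_sum hN hR
  refine ⟨s, fun μ ↦ Module.finrank ℂ (R.eigenspace μ), hs, fun j ↦ ?_⟩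
  rw [← one_mul (R ^ j), h 1 (Commute.one_right R) j]
  refine Finset.sum_congr rfl fun μ _ ↦ ?_
  rw [← LinearMap.trace_one]
  rfl

end TraceDecomposition

section Separation

variable {G : Type} [Group G]

lemma simple_of_isIrreducible [Finite G] {V : Type} [AddCommGroup V] [Module ℂ V]
    [FiniteDimensional ℂ V] (ρ : Representation ℂ G V) [ρ.IsIrreducible] :
    Simple (FDRep.of ρ) := by
  have := Fintype.ofFinite G
  have hcard : (Nat.card G : ℂ) ≠ 0 := Nat.cast_ne_zero.mpr Nat.card_pos.ne'
  have : NeZero (Nat.card G : ℂ) := ⟨hcard⟩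
  have := invertibleOfNonzero hcard
  rw [FDRep.simple_iff_char_is_norm_one]
  have h := Representation.char_orthonormal ρ ρ
  rw [if_pos ⟨.refl ρ⟩, inv_mul_eq_one₀ hcard] at h
  exact h.symm

lemma character_mem_closure_simple [Finite G] (n : ℕ) :
    ∀ {V : Type} [AddCommGroup V] [Module ℂ V] [FiniteDimensional ℂ V]
    (ρ : Representation ℂ G V), Module.finrank ℂ V = n →
    ρ.character ∈ AddSubmonoid.closure {f | ∃ W : FDRep ℂ G, Simple W ∧ W.character = f} := by
  induction n using Nat.strong_induction_on with
  | _ n ih =>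
  intro V _ _ _ ρ hn
  have hcard : (Nat.card G : ℂ) ≠ 0 := Nat.cast_ne_zero.mpr Nat.card_pos.ne'
  have : NeZero (Nat.card G : ℂ) := ⟨hcard⟩
  by_cases hirr : ρ.IsIrreducible
  · exact AddSubmonoid.subset_closure ⟨FDRep.of ρ, simple_of_isIrreducible ρ, rfl⟩
  rcases subsingleton_or_nontrivial V with hV | hV
  · have h0 : ρ.character = 0 := by
      ext g
      rw [Representation.character, Subsingleton.elim (ρ g) 0, map_zero, Pi.zero_apply]
    rw [h0]
    exact zero_mem _
  · have : Nontrivial (Subrepresentation ρ) := by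
      refine ⟨⊥, ⊤, fun h ↦ ?_⟩
      have := congrArg Subrepresentation.toSubmodule h
      exact bot_ne_top this
    obtain ⟨σ, hσb, hσt⟩ : ∃ σ : Subrepresentation ρ, σ ≠ ⊥ ∧ σ ≠ ⊤ := by
      by_contra! hc
      exact hirr ⟨fun σ ↦ or_iff_not_imp_left.mpr (hc σ)⟩
    obtain ⟨τ, hτ⟩ := (inferInstance : ρ.IsSemisimpleRepresentation).exists_isCompl σ
    have hc : IsCompl σ.toSubmodule τ.toSubmodule := by
      constructor
      · rw [disjoint_iff, ← Subrepresentation.toSubmodule_inf, hτ.inf_eq_bot]; rfl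
      · rw [codisjoint_iff, ← Subrepresentation.toSubmodule_sup, hτ.sup_eq_top]; rfl
    have hdim := Submodule.finrank_add_eq_of_isCompl hc
    have h1 : Module.finrank ℂ σ.toSubmodule ≠ 0 := fun h0 ↦ hσb <|
      Subrepresentation.toSubmodule_injective (Submodule.finrank_eq_zero.mp h0)
    have h2 : Module.finrank ℂ τ.toSubmodule ≠ 0 := fun h0 ↦ by
      rw [Submodule.finrank_eq_zero.mp h0] at hc
      exact hσt (Subrepresentation.toSubmodule_injective (eq_top_of_isCompl_bot hc))
    have key : ρ.character = σ.toRepresentation.character + τ.toRepresentation.character := by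
      ext g
      have hintl := (DirectSum.isInternal_submodule_iff_isCompl
        (fun b : Bool ↦ cond b σ.toSubmodule τ.toSubmodule) (i := true) (j := false)
        (by simp) (by ext b; cases b <;> simp)).mpr hc
      have hm : ∀ b : Bool, Set.MapsTo (ρ g)
          ((cond b σ.toSubmodule τ.toSubmodule : Submodule ℂ V) : Set V)
          ((cond b σ.toSubmodule τ.toSubmodule : Submodule ℂ V) : Set V) := by
        rintro (_ | _)
        · exact fun v hv ↦ τ.apply_mem_toSubmodule g hv
        · exact fun v hv ↦ σ.apply_mem_toSubmodule g hv
      rw [Representation.character, LinearMap.trace_eq_sum_trace_restrict hintl hm,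
        Fintype.sum_bool]
      rfl
    rw [key]
    exact add_mem (ih _ (by omega) _ rfl) (ih _ (by omega) _ rfl)

lemma character_eq_of_forall_simple [Finite G] {x y : G}
    (h : ∀ W : FDRep ℂ G, Simple W → W.character x = W.character y)
    {V : Type} [AddCommGroup V] [Module ℂ V] [FiniteDimensional ℂ V]
    (ρ : Representation ℂ G V) : ρ.character x = ρ.character y := by
  refine AddSubmonoid.closure_induction (motive := fun f _ ↦ f x = f y) ?_ rfl
    (fun f g _ _ hf hg ↦ ?_) (character_mem_closure_simple _ ρ rfl)
  · rintro f ⟨W, hW, rfl⟩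
    exact h W hW
  · rw [Pi.add_apply, Pi.add_apply, hf, hg]

/-- The irreducible complex characters of a finite group separate conjugacy classes. -/
lemma isConj_of_forall_simple_character_eq [Finite G] {x y : G}
    (h : ∀ W : FDRep ℂ G, Simple W → W.character x = W.character y) : IsConj x y := by
  classical
  have := Fintype.ofFinite G
  let L : Representation ℂ G (G → ℂ) :=
    { toFun g := LinearMap.funLeft ℂ ℂ (g⁻¹ * ·)
      map_one' := by ext; simp [LinearMap.funLeft]
      map_mul' a b := by ext; simp [LinearMap.funLeft, mul_assoc] }
  let R : Module.End ℂ (G → ℂ) := LinearMap.funLeft ℂ ℂ (· * x)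
  have hLR (g : G) : Commute R (L g) := by
    ext
    simp [L, R, LinearMap.funLeft, mul_assoc]
  have hRpow (j : ℕ) : R ^ j = LinearMap.funLeft ℂ ℂ (· * x ^ j) := by
    induction j with
    | zero => ext; simp [LinearMap.funLeft]
    | succ j ih => rw [pow_succ, ih]; ext; simp [R, LinearMap.funLeft, mul_assoc, pow_succ]
  have hR : R ^ Nat.card G = 1 := by
    rw [hRpow, pow_card_eq_one']; ext; simp [LinearMap.funLeft]
  have htr (g : G) : LinearMap.trace ℂ _ (L g * R) =
      (Finset.univ.filter fun t : G ↦ g⁻¹ * t * x = t).card := by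
    rw [LinearMap.trace_eq_matrix_trace ℂ (Pi.basisFun ℂ G), Matrix.trace, Finset.card_filter,
      Nat.cast_sum]
    refine Finset.sum_congr rfl fun t _ ↦ ?_
    simp [L, R, LinearMap.funLeft, Pi.single_apply]
  have heq : LinearMap.trace ℂ _ (L x * R) = LinearMap.trace ℂ _ (L y * R) := by
    obtain ⟨s, -, hs⟩ := exists_trace_mul_pow_eq_sum Nat.card_pos.ne' hR
    rw [← pow_one R, hs _ (hLR x) 1, hs _ (hLR y) 1]
    refine Finset.sum_congr rfl fun μ _ ↦ congrArg _ ?_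
    let σ : Subrepresentation L :=
      ⟨R.eigenspace μ, fun g _ hv ↦ Module.End.mapsTo_genEigenspace_of_comm (hLR g) μ 1 hv⟩
    exact character_eq_of_forall_simple h σ.toRepresentation
  rw [htr, htr, Nat.cast_inj] at heq
  have hpos : 0 < (Finset.univ.filter fun t : G ↦ y⁻¹ * t * x = t).card := by
    rw [← heq, Finset.card_pos]
    exact ⟨1, by simp⟩
  obtain ⟨t, ht⟩ := Finset.card_pos.mp hpos
  rw [isConj_iff]
  refine ⟨t, ?_⟩
  have ht : y⁻¹ * t * x = t := by simpa using ht
  rw [mul_inv_eq_iff_eq_mul, ← inv_mul_eq_iff_eq_mul, ← mul_assoc, ht]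

end Separation

section Frobenius

open Polynomial

variable {F : Type*} [Field F] [Fintype F]

/-- An irreducible endomorphism over a finite field is conjugate to its image under Frobenius. -/
lemma exists_equiv_pow_card_of_irreducible {V : Type*} [AddCommGroup V] [Module F V]
    [FiniteDimensional F V] [Nontrivial V] (g : Module.End F V)
    (hirr : ∀ p ∈ g.invtSubmodule, p = ⊥ ∨ p = ⊤) :
    ∃ φ : V ≃ₗ[F] V, ∀ v, φ (g v) = (g ^ Fintype.card F) (φ v) := by
  obtain ⟨w, hw⟩ := exists_ne (0 : V)
  let f : F[X] →ₗ[F] V := (LinearMap.applyₗ w).comp (aeval g).toLinearMap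
  let f' : F[X] →ₗ[F] V := (LinearMap.applyₗ w).comp (aeval (g ^ Fintype.card F)).toLinearMap
  have hf (p : F[X]) : f p = aeval g p w := rfl
  have hf' (p : F[X]) : f' p = (aeval g p ^ Fintype.card F) w := by
    change aeval (g ^ Fintype.card F) p w = _
    rw [← expand_aeval, FiniteField.expand_card, map_pow]
  have hsurj : Function.Surjective f := by
    rw [← LinearMap.range_eq_top]
    refine (hirr _ ?_).resolve_left fun h ↦ hw ?_
    · rintro _ ⟨p, rfl⟩
      exact ⟨X * p, by simp [hf]⟩
    · have : f 1 ∈ LinearMap.range f := ⟨1, rfl⟩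
      rw [h, Submodule.mem_bot, hf] at this
      simpa using this
  have hker (p : F[X]) : aeval g p = 0 ∨ Function.Injective (aeval g p) := by
    rw [← LinearMap.ker_eq_top, ← LinearMap.ker_eq_bot, or_comm]
    refine hirr _ fun v hv ↦ ?_
    have hcomm : aeval g p * g = g * aeval g p := by
      simpa using congrArg (aeval g) (mul_comm p X)
    have := LinearMap.congr_fun hcomm v
    simp only [Module.End.mul_apply] at this
    rw [LinearMap.mem_ker] at hv
    simp [this, hv]
  have hiff (p : F[X]) : f p = 0 ↔ f' p = 0 := by
    rw [hf, hf']
    rcases hker p with h | h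
    · simp [h, Fintype.card_ne_zero]
    · rw [map_eq_zero_iff _ h, map_eq_zero_iff]
      rw [Module.End.coe_pow]
      exact h.iterate _
  have hle : LinearMap.ker f ≤ LinearMap.ker f' := fun p hp ↦ (hiff p).mp hp
  let ψ : V →ₗ[F] V :=
    ((LinearMap.ker f).liftQ f' hle).comp (f.quotKerEquivOfSurjective hsurj).symm.toLinearMap
  have hψ (p : F[X]) : ψ (f p) = f' p := by
    have : (f.quotKerEquivOfSurjective hsurj).symm (f p) = (LinearMap.ker f).mkQ p := by
      rw [LinearEquiv.symm_apply_eq]; rfl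
    simp [ψ, this]
  have hinj : Function.Injective ψ := by
    rw [injective_iff_map_eq_zero]
    intro v hv
    obtain ⟨p, rfl⟩ := hsurj v
    rwa [hψ, ← hiff] at hv
  refine ⟨LinearEquiv.ofInjectiveEndo ψ hinj, fun v ↦ ?_⟩
  obtain ⟨p, rfl⟩ := hsurj v
  have hX : g (f p) = f (X * p) := by simp [hf]
  simp only [LinearEquiv.coe_ofInjectiveEndo]
  rw [hX, hψ, hψ]
  simp [f']

lemma exists_equiv_pow_card {N : ℕ} (hN : (N : F) ≠ 0) (n : ℕ) :
    ∀ {V : Type*} [AddCommGroup V] [Module F V] [FiniteDimensional F V] (g : Module.End F V),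
    g ^ N = 1 → Module.finrank F V = n →
    ∃ φ : V ≃ₗ[F] V, ∀ v, φ (g v) = (g ^ Fintype.card F) (φ v) := by
  induction n using Nat.strong_induction_on with
  | _ n ih =>
  intro V _ _ _ g hg hn
  rcases subsingleton_or_nontrivial V with hV | hV
  · exact ⟨LinearEquiv.refl F V, fun v ↦ Subsingleton.elim _ _⟩
  by_cases hirr : ∀ p ∈ g.invtSubmodule, p = ⊥ ∨ p = ⊤
  · exact exists_equiv_pow_card_of_irreducible g hirr
  push Not at hirr
  obtain ⟨p, hp, hpb, hpt⟩ := hirr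
  obtain ⟨p', hp', hc⟩ :=
    Module.End.isSemisimple_iff.mp (isSemisimple_of_pow_eq_one hN hg) p hp
  have hdim := Submodule.finrank_add_eq_of_isCompl hc
  have h1 : Module.finrank F p ≠ 0 := fun h0 ↦ hpb (Submodule.finrank_eq_zero.mp h0)
  have h2 : Module.finrank F p' ≠ 0 := fun h0 ↦ by
    rw [Submodule.finrank_eq_zero.mp h0] at hc
    exact hpt (eq_top_of_isCompl_bot hc)
  have hpow {s : Submodule F V} (hs : s ∈ g.invtSubmodule) (j : ℕ) (v : s) :
      (((g.restrict hs) ^ j) v : V) = (g ^ j) v := by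
    induction j with
    | zero => rfl
    | succ j ih => rw [pow_succ', pow_succ', Module.End.mul_apply, Module.End.mul_apply, ← ih]; rfl
  have hone {s : Submodule F V} (hs : s ∈ g.invtSubmodule) : (g.restrict hs) ^ N = 1 := by
    ext v
    rw [hpow, hg]
    rfl
  obtain ⟨φ, hφ⟩ := ih _ (by omega) (g.restrict hp) (hone hp) rfl
  obtain ⟨φ', hφ'⟩ := ih _ (by omega) (g.restrict hp') (hone hp') rfl
  let e := Submodule.prodEquivOfIsCompl p p' hc
  have he (x : p × p') : e x = x.1 + x.2 := rfl
  refine ⟨(e.symm.trans (φ.prodCongr φ')).trans e, fun v ↦ ?_⟩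
  obtain ⟨⟨a, b⟩, rfl⟩ := e.surjective v
  have hge : g (e (a, b)) = e (g.restrict hp a, g.restrict hp' b) := by
    rw [he, he, map_add]; rfl
  rw [hge]
  simp only [LinearEquiv.trans_apply, LinearEquiv.symm_apply_apply, LinearEquiv.prodCongr_apply]
  rw [hφ, hφ', he, he, map_add, hpow, hpow]

lemma isConj_pow_card {m N : ℕ} (hN : (N : F) ≠ 0) {g : GL (Fin m) F} (hg : g ^ N = 1) :
    IsConj g (g ^ Fintype.card F) := by
  let e := (Matrix.GeneralLinearGroup.toLin (n := Fin m) (R := F))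
  obtain ⟨φ, hφ⟩ := exists_equiv_pow_card hN _ (e g : Module.End F (Fin m → F))
    (by rw [← Units.val_pow_eq_pow_val, ← map_pow, hg, map_one]; rfl) rfl
  have hconj : IsConj (e g) (e (g ^ Fintype.card F)) := by
    rw [isConj_iff]
    refine ⟨LinearMap.GeneralLinearGroup.ofLinearEquiv φ, ?_⟩
    rw [mul_inv_eq_iff_eq_mul, map_pow]
    ext1
    refine LinearMap.ext fun v ↦ ?_
    exact hφ v
  have := e.symm.toMonoidHom.map_isConj hconj
  simpa using this

end Frobenius

section SingleOrbit

open Polynomial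

lemma Squarefree.exists_irreducible_dvd_not_dvd {R : Type*} [EuclideanDomain R] {a b : R}
    (ha : Squarefree a) (ha0 : a ≠ 0) (hab : ¬ a ∣ b) : ∃ p, Irreducible p ∧ p ∣ a ∧ ¬ p ∣ b := by
  classical
  obtain ⟨e, he⟩ := EuclideanDomain.gcd_dvd_left a b
  have he0 : e ≠ 0 := by rintro rfl; exact ha0 (by simpa using he)
  have hu : ¬ IsUnit e := fun hu ↦ hab <| by
    have : a ∣ EuclideanDomain.gcd a b := by
      rw [← hu.dvd_mul_right, ← he]
    exact this.trans (EuclideanDomain.gcd_dvd_right a b)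
  obtain ⟨p, hp, hpe⟩ := WfDvdMonoid.exists_irreducible_factor hu he0
  have hpa : p ∣ a := he ▸ hpe.mul_left _
  refine ⟨p, hp, hpa, fun hpb ↦ hp.not_isUnit (ha p ?_)⟩
  rw [he]
  exact mul_dvd_mul (EuclideanDomain.dvd_gcd hpa hpb) hpe

variable {F : Type*} [Field F]

lemma exists_irreducible_factor_of_orderOf {m ℓ r : ℕ} (hℓ : ℓ.Prime) (hr : 1 ≤ r)
    (hN : ((ℓ ^ r : ℕ) : F) ≠ 0) {g : GL (Fin m) F} (hg : orderOf g = ℓ ^ r) :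
    ∃ p : F[X], ∃ hp : Irreducible p, p.natDegree ≤ m ∧
      haveI := Fact.mk hp
      orderOf (AdjoinRoot.root p) = ℓ ^ r := by
  let A : Matrix (Fin m) (Fin m) F := g.val
  have hpow (j : ℕ) : A ^ j = 1 ↔ g ^ j = 1 := by
    rw [← Units.val_eq_one, Units.val_pow_eq_pow_val]
  have hdvd (j : ℕ) : minpoly F A ∣ X ^ j - 1 ↔ g ^ j = 1 := by
    rw [minpoly.dvd_iff, ← hpow]
    simp [sub_eq_zero]
  have hintl : IsIntegral F A := Matrix.isIntegral A
  have h1 : minpoly F A ∣ X ^ (ℓ ^ r) - 1 := (hdvd _).mpr (hg ▸ pow_orderOf_eq_one g)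
  have h2 : ¬ minpoly F A ∣ X ^ (ℓ ^ (r - 1)) - 1 := by
    rw [hdvd]
    refine pow_ne_one_of_lt_orderOf (pow_pos hℓ.pos _).ne' ?_
    rw [hg]
    exact Nat.pow_lt_pow_right hℓ.one_lt (by omega)
  have hsq : Squarefree (minpoly F A) :=
    ((separable_X_pow_sub_C (1 : F) hN one_ne_zero).squarefree).squarefree_of_dvd
      (by simpa using h1)
  obtain ⟨p, hp, hpA, hpn⟩ := hsq.exists_irreducible_dvd_not_dvd (minpoly.ne_zero hintl) h2
  refine ⟨p, hp, ?_, ?_⟩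
  · have := natDegree_le_of_dvd (hpA.trans (Matrix.minpoly_dvd_charpoly A))
      (Matrix.charpoly_monic A).ne_zero
    simpa [Matrix.charpoly_natDegree_eq_dim] using this
  · have := Fact.mk hp
    have hroot (j : ℕ) : p ∣ X ^ j - 1 ↔ AdjoinRoot.root p ^ j = 1 := by
      rw [← AdjoinRoot.mk_eq_zero]
      simp [sub_eq_zero]
    have := Fact.mk hℓ
    obtain ⟨s, rfl⟩ : ∃ s, r = s + 1 := ⟨r - 1, by omega⟩
    exact orderOf_eq_prime_pow (fun h ↦ hpn ((hroot _).mpr h)) ((hroot _).mp (hpA.trans h1))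

/-- The algebra homomorphism sending `(a, c)` to a matrix of `a • _ ⊕ c • _` on
`K ⊕ F ^ (m - [K : F])`. -/
noncomputable def blockMatrixHom (K : Type*) [Field K] [Algebra F K] {m : ℕ}
    (e : (K × (Fin (m - Module.finrank F K) → F)) ≃ₗ[F] (Fin m → F)) :
    K × F →ₐ[F] Matrix (Fin m) (Fin m) F :=
  ((LinearMap.toMatrixAlgEquiv' (R := F) (n := Fin m)).toAlgHom.comp
    (e.conjAlgEquiv F).toAlgHom).comp
    ((LinearMap.prodMapAlgHom F K (Fin (m - Module.finrank F K) → F)).comp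
      ((Algebra.lmul F K).prodMap (Algebra.ofId F _)))

lemma blockMatrixHom_fst_eq {K : Type*} [Field K] [Algebra F K] {m : ℕ}
    (e : (K × (Fin (m - Module.finrank F K) → F)) ≃ₗ[F] (Fin m → F)) {x y : K × F}
    (h : blockMatrixHom K e x = blockMatrixHom K e y) : x.1 = y.1 := by
  have h' := (e.conjAlgEquiv F).injective
    ((LinearMap.toMatrixAlgEquiv' (R := F) (n := Fin m)).injective h)
  have h1 : x.1 * 1 = y.1 * 1 := congrArg Prod.fst (LinearMap.congr_fun h' (1, 0))
  simpa using h1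

variable [Fintype F]

lemma exists_eq_pow_card_of_aeval_eq_zero {K : Type*} [Field K] [Algebra F K]
    [FiniteDimensional F K] {x y : K} (h : aeval y (minpoly F x) = 0) :
    ∃ i : ℕ, y = x ^ Fintype.card F ^ i := by
  have := Module.finite_of_finite F (M := K)
  obtain ⟨σ, hσ⟩ := minpoly.exists_algEquiv_of_root' (Algebra.IsAlgebraic.isAlgebraic x) h
  obtain ⟨i, hi⟩ := (FiniteField.bijective_frobeniusAlgEquivOfAlgebraic_pow F K).surjective σ
  refine ⟨i, ?_⟩
  rw [← hσ, ← hi]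
  simp only [AlgEquiv.coe_pow, FiniteField.coe_frobeniusAlgEquivOfAlgebraic_iterate]

/-- If `GL_m(F)` has an element of order `ℓ ^ r`, it has one whose eigenvalues of order `ℓ ^ r`
form a single Frobenius orbit. -/
lemma exists_orderOf_eq_and_isConj_pow {m ℓ r : ℕ} (hℓ : ℓ.Prime) (hr : 1 ≤ r)
    (hN : ((ℓ ^ r : ℕ) : F) ≠ 0) (hex : ∃ g : GL (Fin m) F, orderOf g = ℓ ^ r) :
    ∃ g : GL (Fin m) F, orderOf g = ℓ ^ r ∧
      ∀ k : ℕ, IsConj g (g ^ k) → ∃ i : ℕ, k ≡ Fintype.card F ^ i [MOD ℓ ^ r] := by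
  obtain ⟨g₀, hg₀⟩ := hex
  obtain ⟨p, hp, hdeg, hord⟩ := exists_irreducible_factor_of_orderOf hℓ hr hN hg₀
  have := Fact.mk hp
  let K := AdjoinRoot p
  have hfd : FiniteDimensional F K := (AdjoinRoot.powerBasis hp.ne_zero).finite
  have hdim : Module.finrank F K ≤ m := by
    rw [(AdjoinRoot.powerBasis hp.ne_zero).finrank]
    exact hdeg
  let e : (K × (Fin (m - Module.finrank F K) → F)) ≃ₗ[F] (Fin m → F) :=
    LinearEquiv.ofFinrankEq _ _ (by simp; omega)
  let Φ := blockMatrixHom K e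
  let ζ : K := AdjoinRoot.root p
  have hζ0 : ζ ≠ 0 := by
    intro h0
    have : orderOf ζ = 0 := by rw [h0]; exact orderOf_zero _
    rw [hord] at this
    exact (pow_pos hℓ.pos r).ne' this
  let u : (K × F)ˣ := MulEquiv.prodUnits.symm (Units.mk0 ζ hζ0, 1)
  have hu : (u : K × F) = (ζ, 1) := rfl
  let g : GL (Fin m) F := Units.map Φ.toMonoidHom u
  have hg (j : ℕ) : ((g ^ j : GL (Fin m) F) : Matrix (Fin m) (Fin m) F) = Φ (ζ ^ j, 1) := by
    change (Φ (u : K × F)) ^ j = _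
    rw [← map_pow, hu, Prod.pow_mk, one_pow]
  have hgone (j : ℕ) : g ^ j = 1 ↔ ζ ^ j = 1 := by
    rw [← Units.val_eq_one, hg]
    constructor
    · intro h
      rw [← map_one Φ] at h
      exact blockMatrixHom_fst_eq e h
    · intro h
      rw [h]
      exact map_one Φ
  have hgord : orderOf g = ℓ ^ r := (orderOf_eq_orderOf_iff.mpr hgone).trans hord
  refine ⟨g, hgord, fun k hk ↦ ?_⟩
  obtain ⟨c, hc⟩ := isConj_iff.mp hk
  let h : F[X] := minpoly F ζ * (X - 1)
  have haeval (a : K) : aeval (Φ (a, 1)) h = Φ (aeval a h, 0) := by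
    rw [aeval_algHom_apply]
    congr 1
    refine Prod.ext ?_ ?_
    · exact (aeval_algHom_apply (AlgHom.fst F K F) (a, 1) h).symm
    · refine (aeval_algHom_apply (AlgHom.snd F K F) (a, 1) h).symm.trans ?_
      simp [h]
  have hzero : aeval (Φ (ζ ^ k, 1)) h = 0 := by
    have hz : aeval (Φ (ζ, 1)) h = 0 := by
      rw [haeval]
      have : aeval ζ h = 0 := by simp [h]
      rw [this]
      exact map_zero Φ
    have hconj : (Φ (ζ ^ k, 1)) = (c : Matrix (Fin m) (Fin m) F) * Φ (ζ, 1) *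
        ((c⁻¹ : GL (Fin m) F) : Matrix (Fin m) (Fin m) F) := by
      rw [← hg k, ← hc, ← pow_one ζ, ← hg 1, pow_one]
      rfl
    rw [hconj]
    have := aeval_algHom_apply (MulSemiringAction.toAlgHom F (Matrix (Fin m) (Fin m) F)
      (ConjAct.toConjAct c)) (Φ (ζ, 1)) h
    rw [hz, map_zero] at this
    exact this
  have hroot : aeval (ζ ^ k) h = 0 := by
    rw [haeval, ← map_zero Φ] at hzero
    exact blockMatrixHom_fst_eq e hzero
  have hne : ζ ^ k - 1 ≠ 0 := by
    intro h1
    have hgk : g ^ k = 1 := (hgone k).mpr (sub_eq_zero.mp h1)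
    have hg1 : g = 1 := by
      rw [hgk] at hk
      exact isConj_one_left.mp hk
    rw [hg1, orderOf_one] at hgord
    exact (Nat.one_lt_pow (by omega) hℓ.one_lt).ne hgord
  have hmin : aeval (ζ ^ k) (minpoly F ζ) = 0 := by
    have : aeval (ζ ^ k) (minpoly F ζ) * (ζ ^ k - 1) = 0 := by simpa [h] using hroot
    exact (mul_eq_zero.mp this).resolve_right hne
  obtain ⟨i, hi⟩ := exists_eq_pow_card_of_aeval_eq_zero hmin
  refine ⟨i, ?_⟩
  rw [← hord, show AdjoinRoot.root p = (Units.mk0 ζ hζ0 : K) from rfl, orderOf_units,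
    ← pow_eq_pow_iff_modEq]
  exact Units.ext (by simpa using hi)

end SingleOrbit

section GaloisDescent

open IntermediateField

/-- The values `c i 1`, where `c i j` is a sum of `j`-th powers of `N`-th roots of unity, generate
the subfield of the `N`-th cyclotomic extension cut out by the exponents that preserve them. -/
lemma adjoin_le_and_finrank_eq_div_card {K E : Type*} [Field K] [CharZero K] [Field E]
    [Algebra K E] {N : ℕ} [NeZero N] (hirr : Irreducible (Polynomial.cyclotomic N K))
    {z : E} (hz : IsPrimitiveRoot z N) (L : IntermediateField K E)
    [IsCyclotomicExtension {N} K L] (hzL : z ∈ L) {I : Type*} (c : I → ℕ → E)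
    (hc : ∀ i, ∃ (s : Finset E) (d : E → ℕ), (∀ μ ∈ s, μ ^ N = 1) ∧
      ∀ j : ℕ, c i j = ∑ μ ∈ s, μ ^ j * d μ)
    (H : Subgroup (ZMod N)ˣ)
    (hH : ∀ u : (ZMod N)ˣ, u ∈ H ↔ ∀ i, c i (u : ZMod N).val = c i 1) :
    adjoin K {x | ∃ i, c i 1 = x} ≤ L ∧
      Module.finrank K (adjoin K {x | ∃ i, c i 1 = x}) = N.totient / Nat.card H := by
  have hfd : FiniteDimensional K L := IsCyclotomicExtension.finiteDimensional {N} K L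
  have hgal : IsGalois K L := IsCyclotomicExtension.isGalois {N} K L
  let ψ := IsCyclotomicExtension.autEquivPow L hirr
  have hψ (σ : Gal(L/K)) (x : L) (hx : x ^ N = 1) : σ x = x ^ (ψ σ : ZMod N).val := by
    obtain ⟨i, -, rfl⟩ := (IsCyclotomicExtension.zeta_spec N K L).eq_pow_of_pow_eq_one hx
    rw [map_pow, ← (IsCyclotomicExtension.zeta_spec N K L).autToPow_spec K σ, ← pow_mul, ← pow_mul,
      mul_comm]
    rfl
  have hlift (i : I) : ∃ x : ℕ → L, (∀ j, (x j : E) = c i j) ∧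
      ∀ σ : Gal(L/K), σ (x 1) = x (ψ σ : ZMod N).val := by
    obtain ⟨s, d, hs, h⟩ := hc i
    have hsL (μ : E) (hμ : μ ∈ s) : μ ∈ L := by
      obtain ⟨j, -, rfl⟩ := hz.eq_pow_of_pow_eq_one (hs μ hμ)
      exact pow_mem hzL j
    refine ⟨fun j ↦ ∑ μ ∈ s.attach, (⟨μ, hsL μ μ.2⟩ : L) ^ j * d μ, fun j ↦ ?_, fun σ ↦ ?_⟩
    · rw [h, ← Finset.sum_attach]
      simp
    · rw [map_sum]
      refine Finset.sum_congr rfl fun μ _ ↦ ?_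
      rw [map_mul, pow_one, map_natCast, hψ]
      exact Subtype.ext (hs μ μ.2)
  have hle : adjoin K {x | ∃ i, c i 1 = x} ≤ L := by
    rw [adjoin_le_iff]
    rintro _ ⟨i, rfl⟩
    obtain ⟨x, hx, -⟩ := hlift i
    rw [← hx]
    exact (x 1).2
  refine ⟨hle, ?_⟩
  have hfix : (restrict hle).fixingSubgroup = H.comap ψ.toMonoidHom := by
    ext σ
    refine (mem_fixingSubgroup_iff _ σ).trans (Iff.trans ?_ (hH (ψ σ)).symm)
    constructor
    · intro h i
      obtain ⟨x, hx, hσ⟩ := hlift i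
      have := h (x 1) ((mem_restrict hle _).mpr (subset_adjoin K _ ⟨i, (hx 1).symm⟩))
      rw [hσ] at this
      rw [← hx, ← hx, this]
    · intro h x hx
      have hle' : adjoin K {x | ∃ i, c i 1 = x} ≤
          (fixedField (Subgroup.zpowers σ)).map L.val := by
        rw [adjoin_le_iff]
        rintro _ ⟨i, rfl⟩
        obtain ⟨x, hx, hσ⟩ := hlift i
        refine ⟨x 1, ?_, hx 1⟩
        have h1 : σ (x 1) = x 1 := by
          rw [hσ]
          exact Subtype.ext (by rw [hx, hx, h i])
        rintro ⟨τ, hτ⟩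
        obtain ⟨n, rfl⟩ := hτ
        have h2 : σ ∈ MulAction.stabilizer Gal(L/K) (x 1) := h1
        exact zpow_mem h2 n
      obtain ⟨y, hy, hyx⟩ := hle' ((mem_restrict hle x).mp hx)
      obtain rfl : y = x := Subtype.ext hyx
      exact hy ⟨σ, Subgroup.mem_zpowers σ⟩
  have hcard : Module.finrank (restrict hle) L = Nat.card H := by
    rw [← IsGalois.card_fixingSubgroup_eq_finrank, hfix]
    exact Nat.card_congr (ψ.toEquiv.subtypeEquiv fun _ ↦ Iff.rfl)
  have htot : Module.finrank K L = N.totient := IsCyclotomicExtension.finrank L hirr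
  have hmul := Module.finrank_mul_finrank K (restrict hle) L
  rw [hcard, htot, ← (restrictAlgEquiv hle).toLinearEquiv.finrank_eq] at hmul
  rw [← hmul, Nat.mul_div_cancel _ Nat.card_pos]

lemma isCyclotomicExtension_adjoin_of_isPrimitiveRoot {K E : Type*} [Field K] [Field E]
    [Algebra K E] {N : ℕ} [NeZero N] {z : E} (hz : IsPrimitiveRoot z N) :
    IsCyclotomicExtension {N} K (adjoin K {z}) := by
  change IsCyclotomicExtension {N} K (adjoin K {z}).toSubalgebra
  rw [adjoin_simple_toSubalgebra_of_isAlgebraic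
    (hz.isIntegral (NeZero.pos N)).tower_top.isAlgebraic]
  exact hz.adjoin_isCyclotomicExtension K

end GaloisDescent

lemma IsConj.character_eq {G : Type} [Group G] {x y : G} (h : IsConj x y) (V : FDRep ℂ G) :
    V.character x = V.character y := by
  obtain ⟨c, rfl⟩ := isConj_iff.mp h
  exact (V.char_conj x c).symm

lemma exists_character_pow_eq_sum {G : Type} [Group G] (V : FDRep ℂ G) {g : G} {N : ℕ}
    (hN : N ≠ 0) (hg : g ^ N = 1) :
    ∃ (s : Finset ℂ) (d : ℂ → ℕ), (∀ μ ∈ s, μ ^ N = 1) ∧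
      ∀ j : ℕ, V.character (g ^ j) = ∑ μ ∈ s, μ ^ j * d μ := by
  have hR : V.ρ g ^ N = 1 := by rw [← map_pow, hg, map_one]
  obtain ⟨s, d, hs, h⟩ := exists_trace_pow_eq_sum hN hR
  refine ⟨s, d, hs, fun j ↦ ?_⟩
  rw [← h, ← map_pow]
  rfl

lemma FiniteField.natCast_ne_zero {F : Type*} [Field F] [Fintype F] {N : ℕ}
    (h : (Fintype.card F).Coprime N) : (N : F) ≠ 0 := by
  intro h0
  have h1 := (Nat.isCoprime_iff_coprime.mpr h).map (Int.castRingHom F)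
  simp [h0] at h1

section GeneralLinear

variable {F : Type} [Field F] [Fintype F]

lemma isConj_pow_card_pow {m N : ℕ} (hN : (N : F) ≠ 0) {g : GL (Fin m) F} (hg : g ^ N = 1)
    (i : ℕ) : IsConj g (g ^ Fintype.card F ^ i) := by
  induction i with
  | zero => rw [pow_zero, pow_one]
  | succ i ih =>
    rw [pow_succ, pow_mul]
    refine ih.trans (isConj_pow_card hN ?_)
    rw [← pow_mul, mul_comm, pow_mul, hg, one_pow]

/-- The subgroup of exponents fixing all character values at elements of order `ℓ ^ r` of
`GL_m(F)` is generated by the cardinality of `F`. -/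
lemma mem_zpowers_card_iff {m ℓ r : ℕ} (hℓ : ℓ.Prime) (hr : 1 ≤ r)
    (hco : (Fintype.card F).Coprime (ℓ ^ r)) (hex : ∃ g : GL (Fin m) F, orderOf g = ℓ ^ r)
    (u : (ZMod (ℓ ^ r))ˣ) :
    u ∈ Subgroup.zpowers (ZMod.unitOfCoprime _ hco) ↔
      ∀ (V : FDRep ℂ (GL (Fin m) F)), Simple V → ∀ g : GL (Fin m) F, orderOf g = ℓ ^ r →
        V.character (g ^ (u : ZMod (ℓ ^ r)).val) = V.character g := by
  have : NeZero (ℓ ^ r) := ⟨(pow_pos hℓ.pos r).ne'⟩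
  have hN : ((ℓ ^ r : ℕ) : F) ≠ 0 := FiniteField.natCast_ne_zero hco
  have hval (i : ℕ) : (u : ZMod (ℓ ^ r)).val ≡ Fintype.card F ^ i [MOD ℓ ^ r] ↔
      ZMod.unitOfCoprime _ hco ^ i = u := by
    rw [← ZMod.natCast_eq_natCast_iff, ZMod.natCast_zmod_val, eq_comm, Units.ext_iff]
    simp
  rw [← mem_powers_iff_mem_zpowers, Submonoid.mem_powers_iff]
  constructor
  · rintro ⟨i, hi⟩ V - g hg
    have hpow : g ^ (u : ZMod (ℓ ^ r)).val = g ^ Fintype.card F ^ i := by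
      rw [pow_eq_pow_iff_modEq, hg]
      exact (hval i).mpr hi
    rw [hpow]
    exact ((isConj_pow_card_pow hN (hg ▸ pow_orderOf_eq_one g) i).character_eq V).symm
  · intro h
    obtain ⟨g, hg, hconj⟩ := exists_orderOf_eq_and_isConj_pow hℓ hr hN hex
    obtain ⟨i, hi⟩ := hconj (u : ZMod (ℓ ^ r)).val
      (isConj_of_forall_simple_character_eq fun W hW ↦ (h W hW g hg).symm)
    exact ⟨i, (hval i).mp hi⟩

end GeneralLinear

/-- If `ℓ ≠ p` is an odd prime and `GL_m(F_q)` has an element of order `ℓ^r`,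
then `K_{ℓ^r}(GL_m(F_q))` is a subfield of `ℚ(ζ_{ℓ^r})` of degree
`ℓ^{r−1}(ℓ−1)/ord_{ℓ^r}(q)` over `ℚ`. -/
theorem statement1 (p n m q ℓ r : ℕ) (hp : p.Prime) (hn : 1 ≤ n) (hm : 2 ≤ m)
    (hq : q = p ^ n) (hℓ : ℓ.Prime) (hodd : Odd ℓ) (hne : ℓ ≠ p) (hr : 1 ≤ r)
    (F : Type) [Field F] [Fintype F] (hF : Fintype.card F = q)
    (hex : ∃ g : GL (Fin m) F, orderOf g = ℓ ^ r) :
    charFieldAt (GL (Fin m) F) (ℓ ^ r) ≤ IntermediateField.adjoin ℚ {zeta (ℓ ^ r)} ∧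
      Module.finrank ℚ (charFieldAt (GL (Fin m) F) (ℓ ^ r)) =
        ℓ ^ (r - 1) * (ℓ - 1) / orderOf ((q : ZMod (ℓ ^ r))) := by
  have hNZ : NeZero (ℓ ^ r) := ⟨(pow_pos hℓ.pos r).ne'⟩
  subst hq
  have hco : (Fintype.card F).Coprime (ℓ ^ r) := by
    rw [hF]
    exact Nat.Coprime.pow _ _ ((Nat.coprime_primes hp hℓ).mpr hne.symm)
  have hz : IsPrimitiveRoot (zeta (ℓ ^ r)) (ℓ ^ r) := by
    simpa [zeta] using Complex.isPrimitiveRoot_exp (ℓ ^ r) hNZ.ne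
  have := isCyclotomicExtension_adjoin_of_isPrimitiveRoot (K := ℚ) hz
  let c (i : {i : FDRep ℂ (GL (Fin m) F) × GL (Fin m) F // Simple i.1 ∧ orderOf i.2 = ℓ ^ r})
    (j : ℕ) : ℂ := i.1.1.character (i.1.2 ^ j)
  have hset : charFieldAt (GL (Fin m) F) (ℓ ^ r) =
      IntermediateField.adjoin ℚ {x | ∃ i, c i 1 = x} := by
    rw [charFieldAt]
    congr 1
    ext x
    simp [c, and_assoc]
  have hmain := adjoin_le_and_finrank_eq_div_card
    (Polynomial.cyclotomic.irreducible_rat (NeZero.pos (ℓ ^ r))) hz _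
    (IntermediateField.mem_adjoin_simple_self ℚ _) c
    (fun i ↦ exists_character_pow_eq_sum i.1.1 hNZ.ne (orderOf_dvd_iff_pow_eq_one.mp i.2.2.dvd))
    (Subgroup.zpowers (ZMod.unitOfCoprime _ hco)) (fun u ↦ by
      rw [mem_zpowers_card_iff hℓ hr hco hex]
      simp only [c, pow_one, Subtype.forall, Prod.forall, and_imp]
      exact ⟨fun h V g hV ↦ h V hV g, fun h V hV g ↦ h V g hV⟩)
  rw [hset]
  refine ⟨hmain.1, hmain.2.trans ?_⟩
  rw [Nat.totient_prime_pow hℓ hr, Nat.card_zpowers, ← orderOf_units, ZMod.coe_unitOfCoprime, hF]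
end

section
/- Let p be a prime, q = p^n, and m ≥ 2, and suppose GL_m(F_q) contains an element of order 4. Then K_4(GL_m(F_q)) = ℚ(i) if q ≡ 1 (mod 4), and K_4(GL_m(F_q)) = ℚ otherwise. -/
open CategoryTheory

open Polynomial in
/-- An involution of `F[X] ⧸ (f)` carrying multiplication by `X` to multiplication by `X ^ 3`. -/
lemma exists_involution_quotient {F : Type*} [Field F] (f : F[X]) (h1 : f ∣ X ^ 4 - 1)
    (h2 : f ∣ expand F 3 f) :
    ∃ T : (F[X] ⧸ Submodule.span F[X] {f}) →ₛₗ[(expand F 3 : F[X] →+* F[X])]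
        (F[X] ⧸ Submodule.span F[X] {f}), ∀ x, T (T x) = x := by
  refine ⟨Submodule.mapQ _ _ (RingHom.toSemilinearMap (expand F 3 : F[X] →+* F[X])) ?_, ?_⟩
  · rw [Submodule.span_singleton_le_iff_mem, Submodule.mem_comap]
    exact Ideal.mem_span_singleton.mpr h2
  · intro x
    obtain ⟨x, rfl⟩ := Submodule.mkQ_surjective _ x
    simp only [Submodule.mkQ_apply, Submodule.mapQ_apply, RingHom.coe_toSemilinearMap,
      RingHom.coe_coe]
    rw [Submodule.Quotient.eq, expand_expand]
    refine Ideal.mem_span_singleton.mpr ((h1.trans ?_ : f ∣ X ^ 9 - X).trans ?_)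
    · exact ⟨X * (X ^ 4 + 1), by ring⟩
    · have := sub_dvd_eval_sub (X ^ 9 : F[X]) X (x.map C)
      rwa [Polynomial.eval_map, Polynomial.eval_map, eval₂_C_X, ← comp, ← expand_eq_comp_X_pow]
        at this

open Polynomial in
/-- An endomorphism `φ` with `φ ^ 4 = 1` is conjugate to `φ ^ 3` by an involution, provided every
irreducible factor of `X ^ 4 - 1` divides its own image under `X ↦ X ^ 3`. -/
lemma exists_involution_intertwining {F V : Type*} [Field F] [AddCommGroup V] [Module F V]
    [FiniteDimensional F V] (φ : Module.End F V) (hφ : φ ^ 4 = 1)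
    (H : ∀ p : F[X], Irreducible p → p ∣ X ^ 4 - 1 → p ∣ expand F 3 p) :
    ∃ T : Module.End F V, T * T = 1 ∧ T * φ = φ ^ 3 * T := by
  obtain ⟨ι, _, p, hp, e, ⟨l⟩⟩ := Module.equiv_directSum_of_isTorsion
    (Module.AEval.isTorsion_of_finiteDimensional F V φ)
  classical
  let L := l.trans (DirectSum.linearEquivFunOnFintype F[X] ι
    (fun i => F[X] ⧸ Submodule.span F[X] {p i ^ e i}))
  have key : ∀ y : (i : ι) → F[X] ⧸ Submodule.span F[X] {p i ^ e i},
      (X ^ 4 - 1 : F[X]) • y = 0 := by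
    intro y
    obtain ⟨x, rfl⟩ := L.surjective y
    rw [← map_smul, ← map_zero L]
    congr 1
    apply (Module.AEval'.of φ).symm.injective
    simp [Module.AEval.of_symm_smul, hφ]
  have hd : ∀ i, p i ^ e i ∣ X ^ 4 - 1 := by
    intro i
    have := congrFun (key fun i => Submodule.Quotient.mk 1) i
    rw [Pi.smul_apply, Pi.zero_apply, ← Submodule.Quotient.mk_smul,
      Submodule.Quotient.mk_eq_zero, smul_eq_mul, mul_one] at this
    exact Ideal.mem_span_singleton.mp this
  have hd2 : ∀ i, p i ^ e i ∣ expand F 3 (p i ^ e i) := by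
    intro i
    rcases Nat.eq_zero_or_pos (e i) with h | h
    · simp [h]
    · rw [map_pow]
      exact pow_dvd_pow_of_dvd (H _ (hp i) ((dvd_pow_self _ h.ne').trans (hd i))) _
  choose T hT using fun i => exists_involution_quotient _ (hd i) (hd2 i)
  let S : Module.AEval' φ → Module.AEval' φ := fun x => L.symm fun i => T i (L x i)
  have hSS : ∀ x, S (S x) = x := fun x => by simp [S, hT]
  have hadd : ∀ x y, S (x + y) = S x + S y := fun x y => by
    simp only [S, ← map_add]
    congr 1; ext i; simp
  have hsmul : ∀ (f : F[X]) x, S (f • x) = expand F 3 f • S x := fun f x => by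
    simp only [S, ← map_smul]
    congr 1; ext i; simp [LinearMap.map_smulₛₗ]
  let o := Module.AEval'.of φ
  refine ⟨{ toFun := fun v => o.symm (S (o v)), map_add' := ?_, map_smul' := ?_ }, ?_, ?_⟩
  · intro x y; simp [hadd]
  · intro c x
    simp only [RingHom.id_apply, map_smul]
    rw [← Module.AEval.C_smul, hsmul, expand_C, Module.AEval.C_smul, map_smul]
  · ext v; simp [hSS]
  · ext v
    simp only [Module.End.mul_apply, LinearMap.coe_mk, AddHom.coe_mk]
    have : o (φ v) = (X : F[X]) • o v := (Module.AEval'.X_smul_of φ v).symm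
    rw [this, hsmul, expand_X]
    simp [o, Module.AEval.of_symm_smul]

open Polynomial in
lemma dvd_expand_three {F : Type*} [Field F] [Fintype F] (hF : Fintype.card F % 4 ≠ 1) (p : F[X])
    (hp : Irreducible p) (h : p ∣ X ^ 4 - 1) : p ∣ expand F 3 p := by
  have aux : ∀ f : F[X], Irreducible f → f ∣ expand F 3 f → p ∣ f → p ∣ expand F 3 p := by
    intro f hf h1 h2
    obtain ⟨u, rfl⟩ := (hp.associated_of_dvd hf h2).symm
    rw [map_mul]
    exact (Units.mul_right_dvd.mpr h1).mul_right _
  have h1 : p ∣ X - C 1 → p ∣ expand F 3 p := aux _ (irreducible_X_sub_C _)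
    ⟨X ^ 2 + X + 1, by simp; ring⟩
  have h2 : p ∣ X - C (-1) → p ∣ expand F 3 p := aux _ (irreducible_X_sub_C _)
    ⟨X ^ 2 - X + 1, by simp; ring⟩
  have hfac : (X ^ 4 - 1 : F[X]) = (X - C 1) * (X - C (-1)) * (X ^ 2 + 1) := by simp; ring
  rw [hfac] at h
  rcases hp.prime.dvd_or_dvd h with h | h
  · exact (hp.prime.dvd_or_dvd h).elim h1 h2
  by_cases hs : IsSquare (-1 : F)
  · have h3 := FiniteField.isSquare_neg_one_iff.mp hs
    have hc : ringChar F = 2 := by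
      by_contra hc
      have := FiniteField.odd_card_of_char_ne_two hc
      omega
    have := ringChar.of_eq hc
    have : (X ^ 2 + 1 : F[X]) = (X - C 1) * (X - C 1) := by
      have : (2 : F[X]) = 0 := CharTwo.two_eq_zero
      simp only [map_one]
      linear_combination X * this
    rw [this] at h
    exact (hp.prime.dvd_or_dvd h).elim h1 h1
  · refine aux _ ?_ ⟨X ^ 4 - X ^ 2 + 1, by simp; ring⟩ h
    have hm : (X ^ 2 + 1 : F[X]) = X ^ 2 - C (-1) := by simp
    rw [hm]
    refine X_pow_sub_C_irreducible_of_prime Nat.prime_two fun b hb => hs ⟨b, by rw [← hb, sq]⟩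

/-- Over a finite field of order not congruent to `1` modulo `4`, an element of `GL_m` whose
fourth power is trivial is conjugate to its inverse. -/
lemma isConj_inv_of_pow_four {F : Type*} [Field F] [Fintype F] (hF : Fintype.card F % 4 ≠ 1)
    {m : ℕ} (g : GL (Fin m) F) (hg : g ^ 4 = 1) : ∃ h : GL (Fin m) F, h * g * h⁻¹ = g⁻¹ := by
  obtain ⟨T, hT, hTg⟩ := exists_involution_intertwining (Matrix.toLinAlgEquiv' g.1)
    (by rw [← map_pow, ← Units.val_pow_eq_pow_val, hg]; simp) (dvd_expand_three hF)
  obtain ⟨A, rfl⟩ := Matrix.toLinAlgEquiv'.surjective T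
  have hA : A * A = 1 := Matrix.toLinAlgEquiv'.injective (by simpa using hT)
  have hAg : A * g.1 = g.1 ^ 3 * A := Matrix.toLinAlgEquiv'.injective (by simpa using hTg)
  refine ⟨⟨A, A, hA, hA⟩, ?_⟩
  rw [mul_inv_eq_iff_eq_mul, eq_inv_mul_iff_mul_eq, ← mul_assoc]
  apply Units.ext
  simp only [Units.val_mul]
  rw [mul_assoc, hAg, ← mul_assoc, ← pow_succ', ← Units.val_pow_eq_pow_val, hg]
  simp

lemma isRoot_of_mem_roots_charpoly {V : Type*} [AddCommGroup V] [Module ℂ V] [FiniteDimensional ℂ V]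
    (f : Module.End ℂ V) (P : Polynomial ℂ) (hf : Polynomial.aeval f P = 0) (μ : ℂ)
    (hμ : μ ∈ f.charpoly.roots) : P.IsRoot μ := by
  have h1 : f.HasEigenvalue μ := by
    rw [Module.End.hasEigenvalue_iff_isRoot_charpoly]
    exact Polynomial.isRoot_of_mem_roots hμ
  exact (Module.End.isRoot_of_hasEigenvalue h1).dvd (minpoly.dvd _ _ hf)

/-- The trace of an endomorphism lies in every field containing its eigenvalues. -/
lemma trace_mem_of_aeval_eq_zero {V : Type*} [AddCommGroup V] [Module ℂ V]
    [FiniteDimensional ℂ V] (f : Module.End ℂ V) (P : Polynomial ℂ)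
    (hf : Polynomial.aeval f P = 0) (K : IntermediateField ℚ ℂ)
    (hK : ∀ μ : ℂ, P.IsRoot μ → μ ∈ K) : LinearMap.trace ℂ V f ∈ K := by
  rw [Module.End.trace_eq_sum_roots_charpoly_of_splits (IsAlgClosed.splits _)]
  exact multiset_sum_mem _ fun μ hμ => hK μ (isRoot_of_mem_roots_charpoly f P hf μ hμ)

lemma eq_or_eq_of_pow_four_eq_one {μ : ℂ} (h : μ ^ 4 = 1) :
    μ = 1 ∨ μ = -1 ∨ μ = Complex.I ∨ μ = -Complex.I := by
  have : (μ - 1) * ((μ + 1) * ((μ - Complex.I) * (μ + Complex.I))) = 0 := by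
    linear_combination h - (μ ^ 2 - 1) * Complex.I_sq
  simpa only [mul_eq_zero, sub_eq_zero, add_eq_zero_iff_eq_neg] using this

lemma character_mem_adjoin_I {G : Type} [Group G] (V : FDRep ℂ G) {g : G} (hg : g ^ 4 = 1) :
    V.character g ∈ IntermediateField.adjoin ℚ {Complex.I} := by
  have hI : Complex.I ∈ IntermediateField.adjoin ℚ {Complex.I} :=
    IntermediateField.mem_adjoin_simple_self _ _
  refine trace_mem_of_aeval_eq_zero (V.ρ g) (Polynomial.X ^ 4 - 1) ?_ _ fun μ hμ => ?_
  · rw [map_sub, map_pow, Polynomial.aeval_X, ← map_pow, hg]; simp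
  · rcases eq_or_eq_of_pow_four_eq_one (μ := μ) (by simpa [sub_eq_zero] using hμ)
      with rfl | rfl | rfl | rfl
    · exact one_mem _
    · exact neg_mem (one_mem _)
    · exact hI
    · exact neg_mem hI

/-- A character is rational at an element of order dividing `4` that is conjugate to its
inverse. -/
lemma character_mem_bot_of_isConj_inv {G : Type} [Group G] (V : FDRep ℂ G) {g : G}
    (hg : g ^ 4 = 1) (hc : ∃ h : G, h * g * h⁻¹ = g⁻¹) :
    V.character g ∈ (⊥ : IntermediateField ℚ ℂ) := by
  obtain ⟨h, hh⟩ := hc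
  have hinv : g⁻¹ = g ^ 3 := inv_eq_of_mul_eq_one_right (by rw [← pow_succ', hg])
  have h1 : V.character (g ^ 3) = V.character g := by
    rw [← hinv, ← hh, FDRep.char_conj]
  have h2 : LinearMap.trace ℂ V (V.ρ g + V.ρ g ^ 3) ∈ (⊥ : IntermediateField ℚ ℂ) := by
    refine trace_mem_of_aeval_eq_zero _ (Polynomial.X ^ 3 - Polynomial.C 4 * Polynomial.X) ?_ _ fun μ hμ => ?_
    · have h4 : V.ρ g ^ 4 = 1 := by rw [← map_pow, hg, map_one]
      generalize V.ρ g = A at h4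
      have h5 : (Polynomial.X ^ 4 - 1 : Polynomial ℂ) ∣
          (Polynomial.X + Polynomial.X ^ 3) ^ 3 - Polynomial.C 4 * (Polynomial.X + Polynomial.X ^ 3) :=
        ⟨4 * Polynomial.X + 3 * Polynomial.X ^ 3 + Polynomial.X ^ 5, by
          rw [show (Polynomial.C 4 : Polynomial ℂ) = 4 from rfl]; ring⟩
      obtain ⟨Q, hQ⟩ := h5
      have := congrArg (Polynomial.aeval A) hQ
      simpa [h4] using this
    · have : μ * ((μ - 2) * (μ + 2)) = 0 := by
        have : μ ^ 3 - 4 * μ = 0 := by simpa using hμ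
        linear_combination this
      rcases mul_eq_zero.mp this with rfl | h
      · exact zero_mem _
      rcases mul_eq_zero.mp h with h | h
      · rw [sub_eq_zero.mp h]; exact ofNat_mem _ 2
      · rw [eq_neg_of_add_eq_zero_left h]; exact neg_mem (ofNat_mem _ 2)
  rw [map_add, ← map_pow] at h2
  change V.character g + V.character (g ^ 3) ∈ _ at h2
  rw [h1, ← two_mul] at h2
  have := div_mem h2 (ofNat_mem (⊥ : IntermediateField ℚ ℂ) 2)
  rwa [mul_div_cancel_left₀ _ two_ne_zero] at this

/-- Every linear character of a finite group is the character of a simple representation. -/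
lemma exists_simple_character_eq {G : Type} [Group G] [Finite G] (χ : G →* ℂˣ) :
    ∃ V : FDRep ℂ G, Simple V ∧ ∀ g, V.character g = χ g := by
  have := Fintype.ofFinite G
  let ρ : Representation ℂ G ℂ :=
    ((Algebra.lmul ℂ ℂ : ℂ →ₐ[ℂ] Module.End ℂ ℂ) : ℂ →* Module.End ℂ ℂ).comp
      ((Units.coeHom ℂ).comp χ)
  have hchar : ∀ g, (FDRep.of ρ).character g = χ g := by
    intro g
    change LinearMap.trace ℂ ℂ (ρ g) = _
    have : ρ g = (χ g : ℂ) • LinearMap.id := by ext; simp [ρ]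
    rw [this, map_smul, LinearMap.trace_id]
    simp
  refine ⟨FDRep.of ρ, ?_, hchar⟩
  rw [FDRep.simple_iff_char_is_norm_one]
  simp [hchar]

/-- If `q ≡ 1 (mod 4)`, then `GL_m(F_q)` has an element of order `4` at which some linear character
takes the value `± i`. -/
lemma exists_orderOf_eq_four_linear_character {F : Type} [Field F] [Fintype F]
    (hF : Fintype.card F % 4 = 1) {m : ℕ} (hm : 1 ≤ m) :
    ∃ (g : GL (Fin m) F) (χ : GL (Fin m) F →* ℂˣ), orderOf g = 4 ∧
      ((χ g : ℂ) = Complex.I ∨ (χ g : ℂ) = -Complex.I) := by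
  have hc2 : ringChar F ≠ 2 := fun h => by
    have := FiniteField.even_card_of_char_two h
    omega
  obtain ⟨c, hc⟩ := FiniteField.isSquare_neg_one_iff.mpr (show Fintype.card F % 4 ≠ 3 by omega)
  have hneg : (-1 : F) ≠ 1 := Ring.neg_one_ne_one_of_char_ne_two hc2
  obtain ⟨ψ, hψ⟩ := MulChar.exists_apply_ne_one_of_hasEnoughRootsOfUnity F ℂ hneg
  let u : Fˣ := ⟨c, -c, by rw [mul_neg, ← hc, neg_neg], by rw [neg_mul, ← hc, neg_neg]⟩
  have hu2 : (u : F) ^ 2 = -1 := by rw [sq]; exact hc.symm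
  have hu4 : u ^ 4 = 1 := Units.ext (by
    rw [Units.val_pow_eq_pow_val, show 4 = 2 * 2 from rfl, pow_mul, hu2]; simp)
  let i₀ : Fin m := ⟨0, hm⟩
  let D : Fˣ →* GL (Fin m) F :=
    (Units.map (Matrix.diagonalRingHom (Fin m) F).toMonoidHom).comp
      (MulEquiv.piUnits.symm.toMonoidHom.comp (MonoidHom.mulSingle (fun _ => Fˣ) i₀))
  have hDval : ∀ x : Fˣ, (D x : Matrix (Fin m) (Fin m) F) =
      Matrix.diagonal fun i => ((Pi.mulSingle i₀ x : Fin m → Fˣ) i : F) := fun x => rfl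
  have hdet : ∀ x, Matrix.GeneralLinearGroup.det (D x) = x := by
    intro x
    apply Units.ext
    rw [Matrix.GeneralLinearGroup.val_det_apply, hDval, Matrix.det_diagonal, ← Units.coe_prod,
      Finset.prod_pi_mulSingle']
    simp
  have hDinj : Function.Injective D := Function.LeftInverse.injective hdet
  have hord : orderOf u = 4 := by
    refine orderOf_eq_prime_pow (p := 2) (n := 1) (fun h => hneg ?_) hu4
    rw [← hu2, ← Units.val_pow_eq_pow_val]
    exact congrArg Units.val h
  refine ⟨D u, ψ.toUnitHom.comp Matrix.GeneralLinearGroup.det, ?_, ?_⟩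
  · rw [orderOf_injective D hDinj, hord]
  · have hval : ((ψ.toUnitHom.comp Matrix.GeneralLinearGroup.det (D u) : ℂˣ) : ℂ) = ψ u := by
      rw [MonoidHom.comp_apply, hdet, MulChar.coe_toUnitHom]
    rw [hval]
    have h4 : ψ u ^ 4 = 1 := by
      rw [← map_pow, ← Units.val_pow_eq_pow_val, hu4]; simp
    have h2 : ψ u ^ 2 ≠ 1 := by rwa [← map_pow, hu2]
    rcases eq_or_eq_of_pow_four_eq_one h4 with h | h | h | h
    · simp [h] at h2
    · simp [h] at h2
    · exact .inl h
    · exact .inr h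

/-- If `GL_m(F_q)` contains an element of order `4`, then
`K_4(GL_m(F_q)) = ℚ(i)` if `q ≡ 1 (mod 4)` and `K_4(GL_m(F_q)) = ℚ` otherwise. -/
theorem statement5 (p n m q : ℕ) (hp : p.Prime) (hn : 1 ≤ n) (hm : 2 ≤ m)
    (hq : q = p ^ n) (F : Type) [Field F] [Fintype F] (hF : Fintype.card F = q)
    (hex : ∃ g : GL (Fin m) F, orderOf g = 4) :
    charFieldAt (GL (Fin m) F) 4 =
      if (q : ZMod 4) = 1 then IntermediateField.adjoin ℚ {Complex.I} else ⊥ := by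
  have hiff : (q : ZMod 4) = 1 ↔ Fintype.card F % 4 = 1 := by
    rw [hF, ← Nat.cast_one, ZMod.natCast_eq_natCast_iff]
    rfl
  have hpow : ∀ g : GL (Fin m) F, orderOf g = 4 → g ^ 4 = 1 := fun g hg => hg ▸ pow_orderOf_eq_one g
  unfold charFieldAt
  split_ifs with h <;> rw [hiff] at h
  · apply le_antisymm
    · rw [IntermediateField.adjoin_le_iff]
      rintro _ ⟨V, -, g, hg, rfl⟩
      exact character_mem_adjoin_I V (hpow g hg)
    · rw [IntermediateField.adjoin_simple_le_iff]
      obtain ⟨g, χ, hg, hχ⟩ := exists_orderOf_eq_four_linear_character h (by omega : 1 ≤ m)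
      obtain ⟨V, hV, hVχ⟩ := exists_simple_character_eq χ
      have hmem : (χ g : ℂ) ∈ IntermediateField.adjoin ℚ
          {x : ℂ | ∃ V : FDRep ℂ (GL (Fin m) F), Simple V ∧
            ∃ g, orderOf g = 4 ∧ V.character g = x} :=
        IntermediateField.subset_adjoin _ _ ⟨V, hV, g, hg, hVχ g⟩
      rcases hχ with hχ | hχ
      · rwa [hχ] at hmem
      · rw [hχ] at hmem
        simpa using neg_mem hmem
  · rw [eq_bot_iff, IntermediateField.adjoin_le_iff]
    rintro _ ⟨V, -, g, hg, rfl⟩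
    exact character_mem_bot_of_isConj_inv V (hpow g hg) (isConj_inv_of_pow_four h g (hpow g hg))
end

section
/- Let q = 2^n be a power of 2. Then K(SL_2(F_q)) = ℚ(ζ_{q−1} + ζ_{q−1}^{−1}, ζ_{q+1} + ζ_{q+1}^{−1}). -/
open CategoryTheory

namespace Representation

variable {G : Type} [Group G]

theorem IsIrreducible.character_mem_charField [Finite G] {V : Type} [AddCommGroup V] [Module ℂ V]
    [FiniteDimensional ℂ V] (ρ : Representation ℂ G V) [IsIrreducible ρ] (g : G) :
    ρ.character g ∈ charField G := by
  have := Fintype.ofFinite G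
  have := invertibleOfNonzero (NeZero.ne (Nat.card G : ℂ))
  refine IntermediateField.subset_adjoin _ _ ⟨FDRep.of ρ, ?_, g, rfl⟩
  have h := card_inv_mul_sum_char_mul_char_eq_finrank ρ ρ
  rw [IsIrreducible.finrank_intertwiningMap_self, Nat.cast_one,
    inv_mul_eq_one₀ (NeZero.ne _)] at h
  exact (FDRep.simple_iff_char_is_norm_one _).2 h.symm

theorem character_eq_add_of_isCompl {V : Type} [AddCommGroup V] [Module ℂ V]
    [FiniteDimensional ℂ V] {ρ : Representation ℂ G V} {σ τ : Subrepresentation ρ}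
    (h : IsCompl σ.toSubmodule τ.toSubmodule) (g : G) :
    ρ.character g = σ.toRepresentation.character g + τ.toRepresentation.character g := by
  let N : Bool → Submodule ℂ V := fun b ↦ cond b σ.toSubmodule τ.toSubmodule
  have hN : DirectSum.IsInternal N :=
    (DirectSum.isInternal_submodule_iff_isCompl N (i := true) (j := false) (by simp)
      (by ext b; cases b <;> simp)).2 h
  have hmaps : ∀ b, Set.MapsTo (ρ g) (N b) (N b) := by
    rintro (_ | _)
    · exact τ.apply_mem_toSubmodule g
    · exact σ.apply_mem_toSubmodule g
  rw [character, LinearMap.trace_eq_sum_trace_restrict hN hmaps, Fintype.sum_bool]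
  rfl

theorem character_mem_charField [Finite G] {V : Type} [AddCommGroup V] [Module ℂ V]
    [FiniteDimensional ℂ V] (ρ : Representation ℂ G V) (g : G) :
    ρ.character g ∈ charField G := by
  induction hd : Module.finrank ℂ V using Nat.strong_induction_on generalizing V with
  | _ d ih =>
  subst hd
  rcases subsingleton_or_nontrivial V with hV | hV
  · have : ρ g = 0 := Subsingleton.elim _ _
    rw [character, this, map_zero]
    exact zero_mem _
  by_cases hirr : IsIrreducible ρ
  · exact IsIrreducible.character_mem_charField ρ g
  have hnt : Nontrivial (Subrepresentation ρ) :=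
    ⟨⊥, ⊤, fun h ↦ bot_ne_top (α := Submodule ℂ V)
      (congrArg Subrepresentation.toSubmodule h)⟩
  obtain ⟨σ, hbot, htop⟩ : ∃ σ : Subrepresentation ρ, σ ≠ ⊥ ∧ σ ≠ ⊤ := by
    by_contra! H
    exact hirr ⟨fun σ ↦ or_iff_not_imp_left.2 (H σ)⟩
  obtain ⟨τ, hτ⟩ := exists_isCompl σ
  have hc : IsCompl σ.toSubmodule τ.toSubmodule :=
    IsCompl.of_eq (congrArg Subrepresentation.toSubmodule hτ.inf_eq_bot)
      (congrArg Subrepresentation.toSubmodule hτ.sup_eq_top)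
  have hσ : σ.toSubmodule ≠ ⊤ := fun h ↦ htop (Subrepresentation.toSubmodule_injective h)
  have hτ' : τ.toSubmodule ≠ ⊤ := fun h ↦ hbot (Subrepresentation.toSubmodule_injective
    (eq_bot_of_isCompl_top (h ▸ hc)))
  rw [character_eq_add_of_isCompl hc]
  exact add_mem (ih _ (Submodule.finrank_lt hσ) _ rfl)
    (ih _ (Submodule.finrank_lt hτ') _ rfl)

theorem trace_mul_mem_charField [Finite G] {V : Type} [AddCommGroup V] [Module ℂ V]
    [FiniteDimensional ℂ V] (ρ : Representation ℂ G V) {e : Module.End ℂ V}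
    (he : IsIdempotentElem e) (hcomm : ∀ g, Commute (ρ g) e) (g : G) :
    LinearMap.trace ℂ V (ρ g * e) ∈ charField G := by
  let σ : Subrepresentation ρ :=
    { toSubmodule := LinearMap.range e
      apply_mem_toSubmodule := by
        rintro g _ ⟨v, rfl⟩
        exact ⟨ρ g v, (LinearMap.congr_fun (hcomm g).eq v).symm⟩ }
  convert character_mem_charField σ.toRepresentation g using 1
  have h1 : ρ g * e = (ρ g ∘ₗ (LinearMap.range e).subtype) ∘ₗ e.rangeRestrict := rfl
  rw [h1, LinearMap.trace_comp_comm', character]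
  congr 1
  ext ⟨_, v, rfl⟩
  change e (ρ g (e v)) = ρ g (e v)
  rw [← Module.End.mul_apply, ← (hcomm g).eq, Module.End.mul_apply, ← Module.End.mul_apply e e, he.eq]

end Representation

theorem LinearMap.trace_funLeft {X : Type*} [Fintype X] [DecidableEq X] (f : X → X) :
    LinearMap.trace ℂ (X → ℂ) (LinearMap.funLeft ℂ ℂ f) =
      (Finset.univ.filter fun x ↦ f x = x).card := by
  rw [LinearMap.trace_eq_matrix_trace ℂ (Pi.basisFun ℂ X), Matrix.trace]
  simp [LinearMap.funLeft_apply, Pi.single_apply]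

theorem isIdempotentElem_sum_range_pow {A : Type*} [Ring A] [Algebra ℂ A] {b : A} {N : ℕ}
    (hN : N ≠ 0) (hb : b ^ N = 1) :
    IsIdempotentElem ((N : ℂ)⁻¹ • ∑ k ∈ Finset.range N, b ^ k) := by
  have h1 : b * ∑ k ∈ Finset.range N, b ^ k = ∑ k ∈ Finset.range N, b ^ k := by
    have := mul_geom_sum b N
    rw [hb, sub_self, sub_mul, one_mul, sub_eq_zero] at this
    exact this
  have h2 (k : ℕ) : b ^ k * ∑ k ∈ Finset.range N, b ^ k = ∑ k ∈ Finset.range N, b ^ k := by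
    induction k with
    | zero => simp
    | succ k ih => rw [pow_succ, mul_assoc, h1, ih]
  have hN' : (N : ℂ) ≠ 0 := Nat.cast_ne_zero.2 hN
  rw [IsIdempotentElem, smul_mul_assoc, mul_smul_comm]
  congr 1
  rw [Finset.sum_mul, Finset.sum_congr rfl fun k _ ↦ h2 k, Finset.sum_const, Finset.card_range,
    ← Nat.cast_smul_eq_nsmul ℂ, smul_smul, inv_mul_cancel₀ hN', one_smul]

/-- The left regular representation of `G` on complex functions. -/
noncomputable def leftRegularFun (G : Type) [Group G] : Representation ℂ G (G → ℂ) where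
  toFun h := LinearMap.funLeft ℂ ℂ fun x ↦ h⁻¹ * x
  map_one' := by ext; simp [LinearMap.funLeft_apply]
  map_mul' a b := by ext; simp [LinearMap.funLeft_apply, mul_assoc]

theorem funLeft_mul_right_pow {G : Type} [Group G] (g : G) (k : ℕ) :
    (LinearMap.funLeft ℂ ℂ fun x ↦ x * g) ^ k = LinearMap.funLeft ℂ ℂ fun x : G ↦ x * g ^ k := by
  induction k with
  | zero => simp; rfl
  | succ k ih =>
    rw [pow_succ', ih]
    ext
    simp [LinearMap.funLeft_apply, mul_assoc, pow_succ']

theorem sum_inv_pow_mul_card_mem_charField {G : Type} [Group G] [Fintype G] [DecidableEq G]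
    {g : G} {N : ℕ} (hN : N ≠ 0) (hg : g ^ N = 1) {z : ℂ} (hz : z ^ N = 1) :
    ∑ k ∈ Finset.range N, z⁻¹ ^ k * (Finset.univ.filter fun x ↦ x * g ^ k = g * x).card ∈
      charField G := by
  let R : Module.End ℂ (G → ℂ) := LinearMap.funLeft ℂ ℂ fun x ↦ x * g
  have hR (k : ℕ) : (z⁻¹ • R) ^ k = z⁻¹ ^ k • LinearMap.funLeft ℂ ℂ fun x ↦ x * g ^ k := by
    rw [smul_pow, funLeft_mul_right_pow]
  have hcomm (h : G) : Commute (leftRegularFun G h) R := by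
    ext
    simp [R, leftRegularFun, LinearMap.funLeft_apply, mul_assoc]
  have he := isIdempotentElem_sum_range_pow (b := z⁻¹ • R) hN (by
    rw [hR, hg, inv_pow, hz]; simp; rfl)
  have key := Representation.trace_mul_mem_charField (leftRegularFun G) he (fun h ↦
    (Commute.sum_right _ _ _ fun k _ ↦ ((hcomm h).smul_right _).pow_right k).smul_right _) g
  have hNmem : (N : ℂ) ∈ charField G := natCast_mem _ N
  convert mul_mem hNmem key using 1
  rw [mul_smul_comm, map_smul, smul_eq_mul, mul_inv_cancel_left₀ (Nat.cast_ne_zero.2 hN),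
    Finset.mul_sum, map_sum]
  refine Finset.sum_congr rfl fun k _ ↦ ?_
  rw [hR, mul_smul_comm, map_smul, smul_eq_mul, leftRegularFun]
  congr 1
  have : (LinearMap.funLeft ℂ ℂ fun x : G ↦ g⁻¹ * x) * (LinearMap.funLeft ℂ ℂ fun x ↦ x * g ^ k) =
      LinearMap.funLeft ℂ ℂ fun x ↦ g⁻¹ * x * g ^ k := by
    ext
    simp [LinearMap.funLeft_apply]
  refine Eq.trans ?_ (congrArg (LinearMap.trace ℂ (G → ℂ)) this).symm
  rw [LinearMap.trace_funLeft]
  simp [mul_assoc, inv_mul_eq_iff_eq_mul]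

theorem add_inv_mem_charField {G : Type} [Group G] [Finite G] {g : G} {N : ℕ} (hN : 2 < N)
    (hg : g ^ N = 1) (hreal : IsConj g g⁻¹)
    (hconj : ∀ k < N, IsConj g (g ^ k) → k = 1 ∨ k = N - 1) {z : ℂ} (hz : z ^ N = 1) :
    z + z⁻¹ ∈ charField G := by
  classical
  have := Fintype.ofFinite G
  have hginv : g ^ (N - 1) = g⁻¹ :=
    eq_inv_of_mul_eq_one_left (by rw [← pow_succ, Nat.sub_add_cancel (by omega), hg])
  have hzinv : z⁻¹ ^ (N - 1) = z := by
    have hz0 : z ≠ 0 := by rintro rfl; simp [show N ≠ 0 by omega] at hz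
    rw [inv_pow, inv_eq_iff_eq_inv]
    exact eq_inv_of_mul_eq_one_left (by rw [← pow_succ, Nat.sub_add_cancel (by omega), hz])
  have key := sum_inv_pow_mul_card_mem_charField (by omega) hg hz
  rw [← Finset.sum_subset (s₁ := {1, N - 1})] at key
  rotate_left
  · intro k; simp; omega
  · intro k hk hk'
    rw [Finset.card_eq_zero.2, Nat.cast_zero, mul_zero]
    refine Finset.filter_eq_empty_iff.2 fun x _ hx ↦ hk' ?_
    have : IsConj (g ^ k) g := isConj_iff.2 ⟨x, by rw [hx, mul_inv_cancel_right]⟩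
    simpa using hconj k (Finset.mem_range.1 hk) this.symm
  rw [Finset.sum_pair (by omega), hginv, hzinv, pow_one, pow_one] at key
  obtain ⟨c, hc⟩ := isConj_iff.1 hreal
  have hcard : (Finset.univ.filter fun x ↦ x * g⁻¹ = g * x).card =
      (Finset.univ.filter fun x ↦ x * g = g * x).card := by
    refine Finset.card_equiv (Equiv.mulRight c) fun x ↦ ?_
    simp only [Finset.mem_filter, Finset.mem_univ, true_and, Equiv.coe_mulRight, ← hc]
    constructor <;> intro h
    · rw [← mul_assoc, ← h]; group
    · rw [← mul_left_inj c, mul_assoc g, ← h]; group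
  rw [hcard, ← add_mul] at key
  have hpos : ((Finset.univ.filter fun x ↦ x * g = g * x).card : ℂ) ≠ 0 :=
    Nat.cast_ne_zero.2 (Finset.card_ne_zero_of_mem (a := 1) (by simp))
  have := div_mem key (natCast_mem (charField G) (Finset.univ.filter fun x ↦ x * g = g * x).card)
  rwa [mul_div_cancel_right₀ _ hpos, add_comm] at this

theorem trace_add_trace_mem {V : Type*} [AddCommGroup V] [Module ℂ V] [FiniteDimensional ℂ V]
    {T S : Module.End ℂ V} {N : ℕ} (hTS : S * T = 1) (hT : T ^ N = 1) (hN : N ≠ 0)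
    {L : IntermediateField ℚ ℂ} (hL : ∀ z : ℂ, z ^ N = 1 → z + z⁻¹ ∈ L) :
    LinearMap.trace ℂ V T + LinearMap.trace ℂ V S ∈ L := by
  rcases subsingleton_or_nontrivial V with hV | hV
  · rw [Subsingleton.elim T 0, Subsingleton.elim S 0, map_zero, add_zero]
    exact zero_mem _
  have hS : S = T ^ (N - 1) := by
    have : T ^ N = T * T ^ (N - 1) := by rw [← pow_succ', Nat.sub_add_cancel (by omega)]
    calc S = S * T ^ N := by rw [hT, mul_one]
      _ = T ^ (N - 1) := by rw [this, ← mul_assoc, hTS, one_mul]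
  rw [← map_add, Module.End.trace_eq_sum_roots_charpoly_of_splits (IsAlgClosed.splits _)]
  refine multiset_sum_mem _ fun μ hμ ↦ ?_
  have hμ := (Module.End.mem_spectrum_iff_isRoot_charpoly _ _).2 (Polynomial.isRoot_of_mem_roots hμ)
  have hA : T + S = Polynomial.aeval T (Polynomial.X + Polynomial.X ^ (N - 1) : Polynomial ℂ) := by
    simp [hS]
  rw [hA, spectrum.map_polynomial_aeval_of_nonempty _ _
    (spectrum.nonempty_of_isAlgClosed_of_finiteDimensional ℂ T)] at hμ
  obtain ⟨z, hz, rfl⟩ := hμ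
  have hzN : z ^ N = 1 := by
    have := spectrum.pow_mem_pow T N hz
    rwa [hT, spectrum.one_eq, Set.mem_singleton_iff] at this
  have hz1 : z ^ (N - 1) = z⁻¹ :=
    eq_inv_of_mul_eq_one_left (by rw [← pow_succ, Nat.sub_add_cancel (by omega), hzN])
  simpa [hz1] using hL z hzN

theorem FDRep.character_mem_of_isConj_inv {G : Type} [Group G] (V : FDRep ℂ G) {g : G} {N : ℕ}
    (hreal : IsConj g g⁻¹) (hg : g ^ N = 1) (hN : N ≠ 0)
    {L : IntermediateField ℚ ℂ} (hL : ∀ z : ℂ, z ^ N = 1 → z + z⁻¹ ∈ L) :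
    V.character g ∈ L := by
  obtain ⟨c, hc⟩ := isConj_iff.1 hreal
  have h : V.character g + V.character g⁻¹ ∈ L :=
    trace_add_trace_mem (by rw [← map_mul, inv_mul_cancel, map_one]) (by rw [← map_pow, hg, map_one])
      hN hL
  rw [← hc, FDRep.char_conj, ← two_mul] at h
  have := div_mem h (ofNat_mem L 2)
  rwa [mul_div_cancel_left₀ _ two_ne_zero] at this

theorem zeta_isPrimitiveRoot {N : ℕ} (hN : N ≠ 0) : IsPrimitiveRoot (zeta N) N :=
  Complex.isPrimitiveRoot_exp N hN

theorem pow_add_inv_pow_mem {L : IntermediateField ℚ ℂ} {z : ℂ} (hz0 : z ≠ 0) (hz : z + z⁻¹ ∈ L)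
    (k : ℕ) : z ^ k + z⁻¹ ^ k ∈ L := by
  induction k using Nat.twoStepInduction with
  | zero => simpa using add_mem (one_mem L) (one_mem L)
  | one => simpa using hz
  | more k h0 h1 =>
    have : z ^ (k + 2) + z⁻¹ ^ (k + 2) =
        (z + z⁻¹) * (z ^ (k + 1) + z⁻¹ ^ (k + 1)) - (z ^ k + z⁻¹ ^ k) := by
      have : z * z⁻¹ = 1 := mul_inv_cancel₀ hz0
      linear_combination (-z ^ k - z⁻¹ ^ k) * this
    rw [this]
    exact sub_mem (mul_mem hz h1) h0

theorem add_inv_mem_of_pow_eq_one {N : ℕ} (hN : N ≠ 0) {L : IntermediateField ℚ ℂ}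
    (hL : zeta N + (zeta N)⁻¹ ∈ L) {z : ℂ} (hz : z ^ N = 1) : z + z⁻¹ ∈ L := by
  have := NeZero.mk hN
  obtain ⟨k, -, rfl⟩ := (zeta_isPrimitiveRoot hN).eq_pow_of_pow_eq_one hz
  rw [← inv_pow]
  exact pow_add_inv_pow_mem ((zeta_isPrimitiveRoot hN).ne_zero hN) hL k

namespace Matrix.SpecialLinearGroup

variable {F : Type} [Field F]

theorem isConj_inv_of_two_eq_zero (h2 : (2 : F) = 0) (hsq : ∀ x : F, ∃ y, x = y * y)
    (g : SpecialLinearGroup (Fin 2) F) : IsConj g g⁻¹ := by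
  suffices H : ∃ p r s : F, p * (g 0 0 + g 1 1) = g 0 1 * s + g 1 0 * r ∧ p * p + r * s ≠ 0 by
    obtain ⟨p, r, s, h, hD⟩ := H
    obtain ⟨d, hd⟩ := hsq (p * p + r * s)
    have hd0 : d ≠ 0 := by rintro rfl; simp [hd] at hD
    have hx : !![p / d, r / d; s / d, p / d].det = 1 := by
      rw [det_fin_two_of]
      field_simp
      linear_combination hd - r * s * h2
    obtain ⟨x, hx⟩ : ∃ x : SpecialLinearGroup (Fin 2) F, x.1 = !![p / d, r / d; s / d, p / d] :=
      ⟨⟨_, hx⟩, rfl⟩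
    refine isConj_iff.2 ⟨x, mul_inv_eq_iff_eq_mul.2 (Subtype.ext ?_)⟩
    rw [SpecialLinearGroup.coe_mul, SpecialLinearGroup.coe_mul, SpecialLinearGroup.coe_inv, hx,
      adjugate_fin_two]
    ext i j
    fin_cases i <;> fin_cases j <;>
      simp [Matrix.mul_apply, Fin.sum_univ_two] <;> field_simp
    · linear_combination h - p * g 1 1 * h2 + (g 0 1 * s + r * g 1 0) * h2
    · linear_combination g 0 1 * p * h2
    · linear_combination g 1 0 * p * h2
    · linear_combination h - p * g 0 0 * h2 + (g 1 0 * r + g 0 1 * s) * h2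
  by_cases ht : g 0 0 + g 1 1 = 0
  · exact ⟨1, 0, 0, by simp [ht]⟩
  by_cases hb : g 0 1 = 0
  · by_cases hc : g 1 0 = 0
    · exact ⟨0, 1, 1, by simp [hb, hc]⟩
    · exact ⟨g 1 0, g 0 0 + g 1 1, 0, by simp [hc]⟩
  · exact ⟨g 0 1, 0, g 0 0 + g 1 1, by simp [hb]⟩

theorem sq_eq_trace_smul_sub_one (g : SpecialLinearGroup (Fin 2) F) :
    (g : Matrix (Fin 2) (Fin 2) F) ^ 2 = g.1.trace • g.1 - 1 := by
  have h := g.1.aeval_self_charpoly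
  rw [charpoly_fin_two, g.det_coe] at h
  simp only [map_add, map_sub, map_pow, map_mul, Polynomial.aeval_X, Polynomial.aeval_C,
    map_one, ← Algebra.smul_def] at h
  rw [← sub_eq_zero, ← h]
  abel

theorem sq_eq_one_of_trace_eq_zero (h2 : (2 : F) = 0) {g : SpecialLinearGroup (Fin 2) F}
    (ht : g.1.trace = 0) : g ^ 2 = 1 := by
  apply Subtype.ext
  rw [SpecialLinearGroup.coe_pow, sq_eq_trace_smul_sub_one, ht, zero_smul, zero_sub,
    SpecialLinearGroup.coe_one, neg_eq_iff_add_eq_zero, one_add_one_eq_two]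
  rw [← map_ofNat (scalar (Fin 2)) 2, h2, map_zero]

theorem exists_trace_eq (t : F) : ∃ g : SpecialLinearGroup (Fin 2) F, g.1.trace = t :=
  ⟨⟨!![0, -1; 1, t], by simp⟩, by simp [trace_fin_two]⟩

variable {E : Type*} [Field E] [Algebra F E]

open Polynomial in
theorem pow_eq_one_of_trace_eq {g : SpecialLinearGroup (Fin 2) F} {a : E} {N : ℕ}
    (ha : a ≠ 0) (hne : a ≠ a⁻¹) (ht : algebraMap F E g.1.trace = a + a⁻¹) (hN : a ^ N = 1) :
    g ^ N = 1 := by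
  have hdvd : (X - C a) * (X - C a⁻¹) ∣ (X ^ N - 1 : E[X]) := by
    refine (isCoprime_X_sub_C_of_isUnit_sub (sub_ne_zero.2 hne).isUnit).mul_dvd ?_ ?_ <;>
      rw [dvd_iff_isRoot] <;> simp [hN]
  obtain ⟨r, hr⟩ := hdvd
  have hchar : ((X - C a) * (X - C a⁻¹) : E[X]) = (g.1.map (algebraMap F E)).charpoly := by
    have hdet : (g.1.map (algebraMap F E)).det = 1 := by
      rw [← RingHom.mapMatrix_apply, ← RingHom.map_det, g.det_coe, map_one]
    have htr : (g.1.map (algebraMap F E)).trace = a + a⁻¹ := by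
      rw [← ht]; simp [trace_fin_two]
    have : (C a * C a⁻¹ : E[X]) = 1 := by rw [← C_mul, mul_inv_cancel₀ ha, C_1]
    rw [charpoly_fin_two, hdet, htr, C_1, C_add]
    linear_combination this
  have h := congrArg (aeval (g.1.map (algebraMap F E))) hr
  rw [map_mul, hchar, aeval_self_charpoly, zero_mul, map_sub, map_pow, aeval_X, map_one,
    sub_eq_zero] at h
  apply Subtype.ext
  apply Matrix.map_injective (algebraMap F E).injective
  rw [SpecialLinearGroup.coe_pow, SpecialLinearGroup.coe_one]
  simpa [← RingHom.mapMatrix_apply] using h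

theorem trace_pow_eq {g : SpecialLinearGroup (Fin 2) F} {a : E} (ha : a ≠ 0)
    (ht : algebraMap F E g.1.trace = a + a⁻¹) (k : ℕ) :
    algebraMap F E (g ^ k).1.trace = a ^ k + a⁻¹ ^ k := by
  induction k using Nat.twoStepInduction with
  | zero => simp [one_add_one_eq_two, map_ofNat (algebraMap F E) 2]
  | one => simpa using ht
  | more k h0 h1 =>
    have h := sq_eq_trace_smul_sub_one g
    have : (g ^ (k + 2)).1.trace = g.1.trace * (g ^ (k + 1)).1.trace - (g ^ k).1.trace := by
      simp only [SpecialLinearGroup.coe_pow]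
      rw [pow_add, h, mul_sub, mul_smul_comm, ← pow_succ, mul_one, trace_sub, trace_smul,
        smul_eq_mul]
    rw [this, map_sub, map_mul, h0, h1, ht]
    linear_combination (a ^ k + a⁻¹ ^ k) * mul_inv_cancel₀ ha

theorem trace_eq_of_isConj {g h : SpecialLinearGroup (Fin 2) F} (hc : IsConj g h) :
    g.1.trace = h.1.trace := by
  obtain ⟨c, rfl⟩ := isConj_iff.1 hc
  rw [SpecialLinearGroup.coe_mul, trace_mul_comm, ← SpecialLinearGroup.coe_mul, ← mul_assoc,
    inv_mul_cancel, one_mul]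

end Matrix.SpecialLinearGroup

section FiniteField

variable {F : Type} [Field F] [Fintype F] {n : ℕ}

theorem FiniteField.two_eq_zero_of_card (hF : Fintype.card F = 2 ^ n) : (2 : F) = 0 := by
  have h : (2 : F) ^ n = 0 := by
    have := Nat.cast_card_eq_zero F
    rwa [hF, Nat.cast_pow, Nat.cast_ofNat] at this
  exact eq_zero_of_pow_eq_zero h

theorem FiniteField.exists_mul_self_of_card (hn : 1 ≤ n) (hF : Fintype.card F = 2 ^ n) (x : F) :
    ∃ y, x = y * y := by
  refine ⟨x ^ 2 ^ (n - 1), ?_⟩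
  rw [← pow_two, ← pow_mul, ← pow_succ, Nat.sub_add_cancel hn, ← hF, FiniteField.pow_card]

variable {E : Type*} [Field E] [Algebra F E]

theorem FiniteField.charP_two_of_card (hF : Fintype.card F = 2 ^ n) : CharP E 2 := by
  refine CharTwo.of_one_ne_zero_of_two_eq_zero one_ne_zero ?_
  rw [← map_ofNat (algebraMap F E) 2, FiniteField.two_eq_zero_of_card hF, map_zero]

open Polynomial in
theorem FiniteField.exists_algebraMap_eq_of_pow_card_eq {x : E} (hx : x ^ Fintype.card F = x) :
    ∃ y : F, algebraMap F E y = x := by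
  have hne := FiniteField.X_pow_card_sub_X_ne_zero F (Fintype.one_lt_card (α := F))
  have hsplits : (X ^ Fintype.card F - X : F[X]).Splits := by
    rw [splits_iff_card_roots, FiniteField.X_pow_card_sub_X_natDegree_eq F Fintype.one_lt_card,
      FiniteField.roots_X_pow_card_sub_X F, ← Finset.card_def, Finset.card_univ]
  exact hsplits.mem_range_of_isRoot hne (by simp [hx])

namespace Matrix.SpecialLinearGroup

theorem pow_eq_one_of_card (hF : Fintype.card F = 2 ^ n) (g : SpecialLinearGroup (Fin 2) F) :
    g ^ 2 = 1 ∨ g ^ (2 ^ n - 1) = 1 ∨ g ^ (2 ^ n + 1) = 1 := by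
  by_cases ht : g.1.trace = 0
  · exact Or.inl (sq_eq_one_of_trace_eq_zero (FiniteField.two_eq_zero_of_card hF) ht)
  right
  set E := AlgebraicClosure F
  have : CharP E 2 := FiniteField.charP_two_of_card hF
  set t := algebraMap F E g.1.trace with ht_def
  have ht0 : t ≠ 0 := by simpa [ht_def] using ht
  have htq : t ^ 2 ^ n = t := by rw [ht_def, ← map_pow, ← hF, FiniteField.pow_card]
  obtain ⟨a, ha⟩ : ∃ a : E, a ^ 2 + 1 = t * a := by
    obtain ⟨a, ha⟩ := IsAlgClosed.exists_root
      (Polynomial.X ^ 2 - Polynomial.C t * Polynomial.X + 1 : Polynomial E) (by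
        have : (Polynomial.X ^ 2 - Polynomial.C t * Polynomial.X + 1 : Polynomial E).degree = 2 := by
          compute_degree!
        simp [this])
    refine ⟨a, ?_⟩
    simp at ha
    linear_combination ha
  have ha0 : a ≠ 0 := by rintro rfl; simp at ha
  have hta : t = a + a⁻¹ := by
    rw [← mul_left_inj' ha0, ← ha, add_mul, inv_mul_cancel₀ ha0, pow_two]
  have hne : a ≠ a⁻¹ := by
    intro h
    rw [← h, CharTwo.add_self_eq_zero] at hta
    exact ht0 hta
  have hb : (a ^ 2 ^ n) ^ 2 + 1 = t * a ^ 2 ^ n := by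
    have := congrArg (· ^ 2 ^ n) ha
    simp only [add_pow_char_pow, mul_pow, one_pow, htq] at this
    rw [← this]; ring
  have hab : (a ^ 2 ^ n - a) * (a ^ 2 ^ n - a⁻¹) = 0 := by
    rw [hta] at hb
    linear_combination hb + mul_inv_cancel₀ ha0
  refine (mul_eq_zero.1 hab).imp (fun h ↦ ?_) fun h ↦ ?_ <;>
    refine pow_eq_one_of_trace_eq ha0 hne hta ?_
  · rw [← mul_left_inj' ha0, ← pow_succ, Nat.sub_add_cancel Nat.one_le_two_pow, one_mul]
    exact sub_eq_zero.1 h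
  · rw [pow_succ, sub_eq_zero.1 h, inv_mul_cancel₀ ha0]

theorem add_inv_mem_charField_of_card (hn : 1 ≤ n) (hF : Fintype.card F = 2 ^ n) {N : ℕ}
    (hN : N = 2 ^ n - 1 ∨ N = 2 ^ n + 1) {z : ℂ} (hz : z ^ N = 1) :
    z + z⁻¹ ∈ charField (SpecialLinearGroup (Fin 2) F) := by
  have heven : 2 ∣ 2 ^ n := dvd_pow_self 2 (by omega)
  have hpos : 0 < 2 ^ n := by positivity
  by_cases hN1 : N = 1
  · rw [hN1, pow_one] at hz
    simpa [hz] using add_mem (one_mem _) (one_mem _)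
  have hN2 : 2 < N := by omega
  have hodd : ¬ 2 ∣ N := by omega
  set E := AlgebraicClosure F
  have hchar : CharP E 2 := FiniteField.charP_two_of_card hF
  have : NeZero (N : E) := ⟨by rwa [Ne, CharP.cast_eq_zero_iff E 2]⟩
  obtain ⟨a, ha⟩ := HasEnoughRootsOfUnity.exists_primitiveRoot E N
  have ha0 : a ≠ 0 := ha.ne_zero (by omega)
  have hne : a ≠ a⁻¹ := by
    intro h
    have : a ^ 2 = 1 := by rw [pow_two]; nth_rw 2 [h]; exact mul_inv_cancel₀ ha0
    have := Nat.le_of_dvd two_pos (ha.dvd_of_pow_eq_one _ this)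
    omega
  obtain ⟨t, ht⟩ : ∃ t : F, algebraMap F E t = a + a⁻¹ := by
    refine FiniteField.exists_algebraMap_eq_of_pow_card_eq ?_
    rw [hF, add_pow_char_pow, inv_pow]
    rcases hN with hN | hN
    · have : a ^ 2 ^ n = a := by
        rw [show 2 ^ n = N + 1 by omega, pow_succ, ha.pow_eq_one, one_mul]
      rw [this]
    · have : a ^ 2 ^ n = a⁻¹ :=
        eq_inv_of_mul_eq_one_left (by rw [← pow_succ, ← hN, ha.pow_eq_one])
      rw [this, inv_inv, add_comm]
  obtain ⟨g, rfl⟩ := exists_trace_eq t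
  refine add_inv_mem_charField hN2 (pow_eq_one_of_trace_eq ha0 hne ht ha.pow_eq_one)
    (isConj_inv_of_two_eq_zero (FiniteField.two_eq_zero_of_card hF)
      (FiniteField.exists_mul_self_of_card hn hF) g) (fun k hk hconj ↦ ?_) hz
  have htr := trace_pow_eq ha0 ht k
  rw [← trace_eq_of_isConj hconj, ht, inv_pow] at htr
  have hk0 : a ^ k ≠ 0 := pow_ne_zero _ ha0
  have hprod : (a ^ k - a) * (a ^ k - a⁻¹) = 0 := by
    have h := congrArg (· * a ^ k) htr
    simp only [add_mul, inv_mul_cancel₀ hk0] at h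
    linear_combination mul_inv_cancel₀ ha0 - h
  refine (mul_eq_zero.1 hprod).imp (fun h ↦ ?_) fun h ↦ ?_
  · exact ha.pow_inj hk (by omega) (by rw [pow_one, sub_eq_zero.1 h])
  · refine ha.pow_inj hk (by omega) ?_
    rw [sub_eq_zero.1 h]
    exact (eq_inv_of_mul_eq_one_left
      (by rw [← pow_succ, Nat.sub_add_cancel (by omega), ha.pow_eq_one])).symm

end Matrix.SpecialLinearGroup

end FiniteField

/-- For `q = 2^n`,
`K(SL_2(F_q)) = ℚ(ζ_{q−1} + ζ_{q−1}^{−1}, ζ_{q+1} + ζ_{q+1}^{−1})`. -/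
theorem statement6 (n q : ℕ) (hn : 1 ≤ n) (hq : q = 2 ^ n)
    (F : Type) [Field F] [Fintype F] (hF : Fintype.card F = q) :
    charField (Matrix.SpecialLinearGroup (Fin 2) F) =
      IntermediateField.adjoin ℚ
        {zeta (q - 1) + (zeta (q - 1))⁻¹, zeta (q + 1) + (zeta (q + 1))⁻¹} := by
  subst hq
  have hq1 : 2 ^ n - 1 ≠ 0 := by
    have := Nat.pow_le_pow_right two_pos hn
    omega
  apply le_antisymm
  · refine IntermediateField.adjoin_le_iff.2 ?_
    rintro _ ⟨V, -, g, rfl⟩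
    have hreal := g.isConj_inv_of_two_eq_zero (FiniteField.two_eq_zero_of_card hF)
      (FiniteField.exists_mul_self_of_card hn hF)
    rcases g.pow_eq_one_of_card hF with h | h | h
    · refine V.character_mem_of_isConj_inv hreal h two_ne_zero fun z hz ↦ ?_
      rcases mul_self_eq_one_iff.1 ((pow_two z).symm.trans hz) with rfl | rfl
      · simpa using add_mem (one_mem _) (one_mem _)
      · simpa using add_mem (neg_mem (one_mem _)) (neg_mem (one_mem _))
    · refine V.character_mem_of_isConj_inv hreal h hq1 fun z hz ↦
        add_inv_mem_of_pow_eq_one hq1 (IntermediateField.subset_adjoin _ _ ?_) hz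
      simp
    · refine V.character_mem_of_isConj_inv hreal h (Nat.succ_ne_zero _) fun z hz ↦
        add_inv_mem_of_pow_eq_one (Nat.succ_ne_zero _) (IntermediateField.subset_adjoin _ _ ?_) hz
      simp
  · refine IntermediateField.adjoin_le_iff.2 ?_
    rintro _ (rfl | rfl)
    · exact Matrix.SpecialLinearGroup.add_inv_mem_charField_of_card hn hF (Or.inl rfl)
        (zeta_isPrimitiveRoot hq1).pow_eq_one
    · exact Matrix.SpecialLinearGroup.add_inv_mem_charField_of_card hn hF (Or.inr rfl)
        (zeta_isPrimitiveRoot (Nat.succ_ne_zero _)).pow_eq_one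
end
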